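/- Let e₁ and e₂ be non-collinear unit vectors in ℝ³ (e₁ ≠ ±e₂), let e = λ₁e₁ + λ₂e₂ with λ₁ > 0, λ₂ > 0, |e| = 1, and let K be any closed subset of the arc Γ = Γ_{e₁,e₂} that contains its endpoints e₁ and e₂. Then there exist a convex body C ⊂ ℝ³ and a point r₀ ∈ ∂C such that the tangent cone to C at r₀ is the dihedral angle {r : (r − r₀, e₁) ≤ 0, (r − r₀, e₂) ≤ 0}, and the normalized surface measures ν_t = ν_{t,e,r₀,C} weakly converge as t → 0⁺ to a measure ν_* on S² whose support equals K. -/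

import Mathlib

open MeasureTheory Set Filter Topology
open scoped RealInnerProductSpace ENNReal

noncomputable section

attribute [local instance] Classical.propDecidable

abbrev E3 := EuclideanSpace ℝ (Fin 3)

/-- A convex body: a compact convex set with nonempty interior. -/
def IsConvexBody (C : Set E3) : Prop :=
  IsCompact C ∧ Convex ℝ C ∧ (interior C).Nonempty

/-- The tangent cone to a convex set `C` at the point `r₀`: the closure of the set of
rays from `r₀` through points of `C`, translated to the origin. -/
def tanCone (C : Set E3) (r₀ : E3) : Set E3 :=
  closure {v : E3 | ∃ c : ℝ, ∃ r ∈ C, 0 ≤ c ∧ v = c • (r - r₀)}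

/-- The dihedral angle `{v : ⟪v,e₁⟫ ≤ 0, ⟪v,e₂⟫ ≤ 0}` (as a cone of displacements). -/
def dihedral (e₁ e₂ : E3) : Set E3 := {v : E3 | ⟪v, e₁⟫ ≤ 0 ∧ ⟪v, e₂⟫ ≤ 0}

/-- `n` is an outward unit normal of `C` at `r`. -/
def IsOutwardNormalAt (C : Set E3) (r n : E3) : Prop :=
  ‖n‖ = 1 ∧ ∀ x ∈ C, ⟪x - r, n⟫ ≤ 0

/-- `r` is a regular boundary point: the outward unit normal exists and is unique. -/
def IsRegularPt (C : Set E3) (r : E3) : Prop :=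
  ∃! n : E3, IsOutwardNormalAt C r n

/-- The (Gauss) normal map of `C`, sending a boundary point to an outward unit normal
(the unique one at regular points), and junk value `0` elsewhere. -/
def normalMap (C : Set E3) (r : E3) : E3 :=
  if h : ∃ n : E3, IsOutwardNormalAt C r n then h.choose else 0

/-- `B_t = C ∩ {r : ⟪r - r₀, e⟫ = -t}`. -/
def Bset (C : Set E3) (r₀ e : E3) (t : ℝ) : Set E3 :=
  C ∩ {r : E3 | ⟪r - r₀, e⟫ = -t}

/-- `S_t = ∂C ∩ {r : ⟪r - r₀, e⟫ ≥ -t}`. -/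
def Sset (C : Set E3) (r₀ e : E3) (t : ℝ) : Set E3 :=
  frontier C ∩ {r : E3 | ⟪r - r₀, e⟫ ≥ -t}

/-- The normalized surface measure `ν_t` induced by `S_t`: the pushforward under the
normal map of the 2-dimensional Hausdorff measure restricted to the regular points of
`S_t`, normalized by the area of `B_t`. -/
def nuT (C : Set E3) (r₀ e : E3) (t : ℝ) : Measure E3 :=
  (μH[2] (Bset C r₀ e t))⁻¹ •
    Measure.map (normalMap C) (μH[2].restrict (Sset C r₀ e t ∩ {r : E3 | IsRegularPt C r}))

/-- The arc `Γ = {μ₁e₁ + μ₂e₂ : |μ₁e₁ + μ₂e₂| = 1, μ₁ ≥ 0, μ₂ ≥ 0}`. -/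
def arcGamma (e₁ e₂ : E3) : Set E3 :=
  {v : E3 | ∃ m₁ m₂ : ℝ, 0 ≤ m₁ ∧ 0 ≤ m₂ ∧ v = m₁ • e₁ + m₂ • e₂ ∧ ‖v‖ = 1}

/-- Weak convergence of the family `ν t` to `ν₀` as `t → 0⁺`. -/
def WeaklyTendsto (ν : ℝ → Measure E3) (ν₀ : Measure E3) : Prop :=
  ∀ f : BoundedContinuousFunction E3 ℝ,
    Tendsto (fun t => ∫ x, f x ∂(ν t)) (𝓝[>] (0 : ℝ)) (𝓝 (∫ x, f x ∂ν₀))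

/-- `ν₀` is a partial weak limit of the family `ν t` as `t → 0⁺`. -/
def IsPartialWeakLimit (ν : ℝ → Measure E3) (ν₀ : Measure E3) : Prop :=
  ∃ ts : ℕ → ℝ, (∀ i, 0 < ts i) ∧ Tendsto ts atTop (𝓝 (0 : ℝ)) ∧
    ∀ f : BoundedContinuousFunction E3 ℝ,
      Tendsto (fun i => ∫ x, f x ∂(ν (ts i))) atTop (𝓝 (∫ x, f x ∂ν₀))

/-- The support of a measure: points all of whose open neighborhoods have positive measure. -/
def msupport (ν : Measure E3) : Set E3 :=
  {x : E3 | ∀ U : Set E3, IsOpen U → x ∈ U → 0 < ν U}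


/-- Comparison of Hausdorff measures of two images. -/
lemma hcmp {X Y Z : Type*} [Nonempty X] [MetricSpace Y] [MeasurableSpace Y] [BorelSpace Y]
    [MetricSpace Z] [MeasurableSpace Z] [BorelSpace Z] (f : X → Y) (g : X → Z) (s : Set X)
    (K : NNReal) (h : ∀ x ∈ s, ∀ y ∈ s, dist (f x) (f y) ≤ K * dist (g x) (g y)) :
    μH[2] (f '' s) ≤ (K : ℝ≥0∞) ^ 2 * μH[2] (g '' s) := by
  have hinv : ∀ x ∈ s, f (Function.invFunOn g s (g x)) = f x := by
    intro x hx
    have h1 : Function.invFunOn g s (g x) ∈ s := Function.invFunOn_mem ⟨x, hx, rfl⟩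
    have h2 : g (Function.invFunOn g s (g x)) = g x := Function.invFunOn_eq ⟨x, hx, rfl⟩
    have h3 := h _ h1 x hx
    rw [h2, dist_self, mul_zero] at h3
    exact dist_le_zero.1 h3
  have hlip : LipschitzOnWith K (f ∘ Function.invFunOn g s) (g '' s) := by
    apply LipschitzOnWith.of_dist_le_mul
    rintro _ ⟨x, hx, rfl⟩ _ ⟨y, hy, rfl⟩
    simp only [Function.comp, hinv x hx, hinv y hy]
    exact h x hx y hy
  have h1 := hlip.hausdorffMeasure_image_le (d := 2) (by norm_num)
  have h2 : (f ∘ Function.invFunOn g s) '' (g '' s) = f '' s := by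
    rw [image_image]
    exact image_congr (fun x hx => hinv x hx)
  rw [h2] at h1
  simpa using h1

abbrev R2 := ℝ × ℝ

/-- An orthonormal frame. -/
structure Fr where
  b : E3
  τ : E3
  u : E3
  bb : ⟪b, b⟫ = 1
  tt : ⟪τ, τ⟫ = 1
  uu : ⟪u, u⟫ = 1
  bt : ⟪b, τ⟫ = 0
  bu : ⟪b, u⟫ = 0
  tu : ⟪τ, u⟫ = 0
  exp : ∀ r : E3, r = ⟪r, τ⟫ • τ + ⟪r, u⟫ • u - (-⟪r, b⟫) • b

namespace Fr
variable (F : Fr)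

lemma tb : ⟪F.τ, F.b⟫ = 0 := by rw [real_inner_comm]; exact F.bt
lemma ub : ⟪F.u, F.b⟫ = 0 := by rw [real_inner_comm]; exact F.bu
lemma ut : ⟪F.u, F.τ⟫ = 0 := by rw [real_inner_comm]; exact F.tu

/-- The point with coordinates `y`, `z`, `h`. -/
def pt (y z h : ℝ) : E3 := y • F.τ + z • F.u - h • F.b

lemma inner_pt (y z h y' z' h' : ℝ) : ⟪F.pt y z h, F.pt y' z' h'⟫ = y * y' + z * z' + h * h' := by
  simp only [pt, inner_add_left, inner_sub_left, inner_add_right, inner_sub_right,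
    real_inner_smul_left, real_inner_smul_right, F.bb, F.tt, F.uu, F.bt, F.bu, F.tu, F.tb, F.ub,
    F.ut]
  ring

lemma norm_pt_sq (y z h : ℝ) : ‖F.pt y z h‖ ^ 2 = y ^ 2 + z ^ 2 + h ^ 2 := by
  rw [← real_inner_self_eq_norm_sq, inner_pt]; ring

lemma pt_sub (y z h y' z' h' : ℝ) :
    F.pt y z h - F.pt y' z' h' = F.pt (y - y') (z - z') (h - h') := by
  simp only [pt]; module

lemma pt_surj (r : E3) : ∃ y z h, r = F.pt y z h := ⟨_, _, _, F.exp r⟩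

lemma pt_inj {y z h y' z' h' : ℝ} (hh : F.pt y z h = F.pt y' z' h') : y = y' ∧ z = z' ∧ h = h' := by
  have h1 := F.norm_pt_sq (y - y') (z - z') (h - h')
  rw [← pt_sub, hh, sub_self, norm_zero] at h1
  refine ⟨?_, ?_, ?_⟩ <;> nlinarith [sq_nonneg (y - y'), sq_nonneg (z - z'), sq_nonneg (h - h')]

lemma norm_le_norm_pt (v : R2) (h : ℝ) : ‖v‖ ≤ ‖F.pt v.1 v.2 h‖ := by
  have h1 := F.norm_pt_sq v.1 v.2 h
  rw [Prod.norm_def, Real.norm_eq_abs, Real.norm_eq_abs]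
  apply max_le <;> apply abs_le_of_sq_le_sq _ (norm_nonneg _) <;> 
    nlinarith [sq_nonneg v.1, sq_nonneg v.2, sq_nonneg h]

lemma norm_pt_le (v : R2) (h : ℝ) : ‖F.pt v.1 v.2 h‖ ≤ 2 * ‖v‖ + |h| := by
  have hb : ‖F.b‖ = 1 := by
    have := real_inner_self_eq_norm_sq F.b; rw [F.bb] at this; nlinarith [norm_nonneg F.b]
  have ht : ‖F.τ‖ = 1 := by
    have := real_inner_self_eq_norm_sq F.τ; rw [F.tt] at this; nlinarith [norm_nonneg F.τ]
  have hu : ‖F.u‖ = 1 := by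
    have := real_inner_self_eq_norm_sq F.u; rw [F.uu] at this; nlinarith [norm_nonneg F.u]
  have h1 := norm_fst_le v
  have h2 := norm_snd_le v
  unfold pt
  calc _ ≤ ‖v.1 • F.τ‖ + ‖v.2 • F.u‖ + ‖h • F.b‖ :=
        (norm_sub_le _ _).trans (add_le_add_left (norm_add_le _ _) _)
    _ ≤ _ := by
      rw [norm_smul, norm_smul, norm_smul, hb, ht, hu, Real.norm_eq_abs h]; linarith

/-- The graph (linear) map with slope `l`. -/
def L (l : R2 →L[ℝ] ℝ) : R2 →L[ℝ] E3 :=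
  (ContinuousLinearMap.fst ℝ ℝ ℝ).smulRight F.τ + (ContinuousLinearMap.snd ℝ ℝ ℝ).smulRight F.u
    - l.smulRight F.b

lemma L_apply (l : R2 →L[ℝ] ℝ) (v : R2) : F.L l v = F.pt v.1 v.2 (l v) := by
  simp [L, pt]

lemma norm_le_L (l : R2 →L[ℝ] ℝ) (v : R2) : ‖v‖ ≤ ‖F.L l v‖ := by
  rw [L_apply]; exact F.norm_le_norm_pt _ _

lemma L_emb (l : R2 →L[ℝ] ℝ) : Topology.IsClosedEmbedding (F.L l) := by
  have : AntilipschitzWith 1 (F.L l) :=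
    (F.L l).antilipschitz_of_bound (fun x => by simpa using F.norm_le_L l x)
  exact this.isClosedEmbedding (F.L l).uniformContinuous

/-- The unit box. -/
def box : Set R2 := Icc 0 1 ×ˢ Icc 0 1

lemma vol_box : volume box = 1 := by
  rw [box, Measure.volume_eq_prod, Measure.prod_prod]; simp

/-- The area factor. -/
def J (l : R2 →L[ℝ] ℝ) : ℝ≥0∞ := μH[2] (F.L l '' box)

lemma L_image_le (l : R2 →L[ℝ] ℝ) (s : Set R2) :
    μH[2] (F.L l '' s) ≤ (‖F.L l‖₊ : ℝ≥0∞) ^ 2 * volume s := by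
  have := hcmp (F.L l) (id : R2 → R2) s ‖F.L l‖₊ (fun x _ y _ => by
    rw [dist_eq_norm, dist_eq_norm, ← map_sub]; exact (F.L l).le_opNorm _)
  rwa [image_id, hausdorffMeasure_prod_real] at this

lemma le_L_image (l : R2 →L[ℝ] ℝ) (s : Set R2) : volume s ≤ μH[2] (F.L l '' s) := by
  have := hcmp (id : R2 → R2) (F.L l) s 1 (fun x _ y _ => by
    rw [dist_eq_norm, dist_eq_norm, ← map_sub, NNReal.coe_one, one_mul]; exact F.norm_le_L l _)
  rw [image_id, hausdorffMeasure_prod_real] at this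
  simpa using this

lemma one_le_J (l : R2 →L[ℝ] ℝ) : 1 ≤ F.J l := by
  rw [← vol_box]; exact F.le_L_image l _

lemma J_lt_top (l : R2 →L[ℝ] ℝ) : F.J l < ⊤ := by
  refine (F.L_image_le l _).trans_lt ?_
  rw [vol_box]
  exact ENNReal.mul_lt_top (by finiteness) (by simp)

lemma L_image (l : R2 →L[ℝ] ℝ) (s : Set R2) :
    μH[2] (F.L l '' s) = F.J l * volume s := by
  have hemb := (F.L_emb l).measurableEmbedding
  set ρ : Measure R2 := Measure.comap (F.L l) μH[2] with hρ
  have happ : ∀ s, ρ s = μH[2] (F.L l '' s) := fun s => hemb.comap_apply _ _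
  have h1 : ρ.IsAddLeftInvariant := by
    constructor
    intro v
    ext s hs
    rw [Measure.map_apply (measurable_const_add v) hs, happ, happ]
    have : F.L l '' s = (fun x => F.L l v + x) '' (F.L l '' ((fun x => v + x) ⁻¹' s)) := by
      rw [image_image]
      ext x
      constructor
      · rintro ⟨y, hy, rfl⟩
        exact ⟨y - v, by simpa using hy, by simp⟩
      · rintro ⟨y, hy, rfl⟩
        exact ⟨v + y, hy, by simp⟩
    rw [this, (isometry_add_left (F.L l v)).hausdorffMeasure_image (Or.inl (by norm_num))]
  have h2 : IsFiniteMeasureOnCompacts ρ := by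
    constructor
    intro K hK
    rw [happ]
    exact (F.L_image_le l K).trans_lt (ENNReal.mul_lt_top (by finiteness) hK.measure_lt_top)
  obtain ⟨c, hc⟩ : ∃ c : NNReal, ρ = c • (volume : Measure R2) :=
    ⟨_, Measure.isAddLeftInvariant_eq_smul ρ (volume : Measure R2)⟩
  have h5 : ∀ s, ρ s = c * volume s := fun s => by
    rw [hc, Measure.smul_apply, ENNReal.smul_def, smul_eq_mul]
  rw [← happ, J, ← happ, h5, h5, vol_box, mul_one]

/-- Comparison of a map that is close to linear, with the linear one. -/
lemma cmp_aux (l : R2 →L[ℝ] ℝ) (g : R2 → ℝ) (s : Set R2) (ε : NNReal)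
    (h : ∀ x ∈ s, ∀ y ∈ s, |g x - g y - l (x - y)| ≤ ε * ‖x - y‖) :
    μH[2] ((fun p => F.pt p.1 p.2 (g p)) '' s) ≤ (1 + ε : ℝ≥0∞) ^ 2 * (F.J l * volume s) ∧
    F.J l * volume s ≤ (1 + ε : ℝ≥0∞) ^ 2 * μH[2] ((fun p => F.pt p.1 p.2 (g p)) '' s) := by
  have hb : ‖F.b‖ = 1 := by
    have := real_inner_self_eq_norm_sq F.b; rw [F.bb] at this; nlinarith [norm_nonneg F.b]
  have key : ∀ x ∈ s, ∀ y ∈ s, ‖(F.pt x.1 x.2 (g x) - F.pt y.1 y.2 (g y)) - F.L l (x - y)‖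
      ≤ ε * ‖x - y‖ := by
    intro x hx y hy
    have : (F.pt x.1 x.2 (g x) - F.pt y.1 y.2 (g y)) - F.L l (x - y)
        = - (g x - g y - l (x - y)) • F.b := by
      rw [L_apply]; simp only [pt, Prod.fst_sub, Prod.snd_sub]; module
    rw [this, norm_smul, hb, mul_one, norm_neg]
    exact h x hx y hy
  rw [← F.L_image]
  constructor
  · have := hcmp (fun p : R2 => F.pt p.1 p.2 (g p)) (F.L l) s (1 + ε) (fun x hx y hy => by
      rw [dist_eq_norm, dist_eq_norm, ← map_sub]
      have h1 := key x hx y hy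
      have h2 := F.norm_le_L l (x - y)
      have h3 := norm_le_norm_add_norm_sub' (F.pt x.1 x.2 (g x) - F.pt y.1 y.2 (g y)) (F.L l (x - y))
      push_cast
      have h4 : (ε : ℝ) * ‖x - y‖ ≤ ε * ‖F.L l (x - y)‖ := by gcongr
      linarith)
    simpa using this
  · have := hcmp (F.L l) (fun p : R2 => F.pt p.1 p.2 (g p)) s (1 + ε) (fun x hx y hy => by
      rw [dist_eq_norm, dist_eq_norm, ← map_sub]
      have h1 := key x hx y hy
      have h2 := F.norm_le_norm_pt (x - y) (g x - g y)
      rw [Prod.fst_sub, Prod.snd_sub, ← F.pt_sub] at h2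
      have h3 := norm_le_norm_add_norm_sub (F.pt x.1 x.2 (g x) - F.pt y.1 y.2 (g y)) (F.L l (x - y))
      push_cast
      have h4 := mul_le_mul_of_nonneg_left h2 ε.coe_nonneg
      linarith)
    simpa using this

lemma J_le (l l' : R2 →L[ℝ] ℝ) : F.J l ≤ (1 + ‖l - l'‖₊ : ℝ≥0∞) ^ 2 * F.J l' := by
  have := (F.cmp_aux l' l box ‖l - l'‖₊ (fun x _ y _ => by
    rw [← map_sub, ← sub_apply]
    exact (l - l').le_opNorm _)).1
  rw [vol_box, mul_one] at this
  refine le_trans (le_of_eq ?_) this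
  rw [J]; congr 1

end Fr

lemma tendsto_aux (k : ℕ) : Tendsto (fun x : NNReal => (1 + (x : ℝ≥0∞)) ^ k) (𝓝 0) (𝓝 1) := by
  have : Continuous (fun x : NNReal => (1 + (x : ℝ≥0∞)) ^ k) := by
    have h : (fun x : NNReal => (1 + (x : ℝ≥0∞)) ^ k) = fun x : NNReal => (((1 + x) ^ k : NNReal) : ℝ≥0∞) := by
      funext x; push_cast; rfl
    rw [h]
    exact ENNReal.continuous_coe.comp (by fun_prop)
  simpa using this.tendsto 0

lemma le_of_eps (k : ℕ) (x y : ℝ≥0∞) (h : ∀ ε : NNReal, 0 < ε → x ≤ (1 + (ε : ℝ≥0∞)) ^ k * y) :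
    x ≤ y := by
  have h1 : Tendsto (fun ε : NNReal => (1 + (ε : ℝ≥0∞)) ^ k * y) (𝓝[>] 0) (𝓝 (1 * y)) :=
    ENNReal.Tendsto.mul_const ((tendsto_aux k).mono_left nhdsWithin_le_nhds) (Or.inl one_ne_zero)
  rw [one_mul] at h1
  exact ge_of_tendsto h1 (by filter_upwards [self_mem_nhdsWithin] with ε hε using h ε hε)

namespace Fr
variable (F : Fr)

lemma J_cont : Continuous F.J := by
  rw [continuous_iff_continuousAt]
  intro l'
  have hn : Tendsto (fun l : R2 →L[ℝ] ℝ => ‖l - l'‖₊) (𝓝 l') (𝓝 0) := by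
    have : Continuous (fun l : R2 →L[ℝ] ℝ => ‖l - l'‖₊) := by fun_prop
    simpa using this.tendsto l'
  have h1 : Tendsto (fun l => (1 + (‖l - l'‖₊ : ℝ≥0∞)) ^ 2) (𝓝 l') (𝓝 1) :=
    (tendsto_aux 2).comp hn
  refine tendsto_of_tendsto_of_tendsto_of_le_of_le
    (g := fun l => ((1 + (‖l - l'‖₊ : ℝ≥0∞)) ^ 2)⁻¹ * F.J l')
    (h := fun l => (1 + (‖l - l'‖₊ : ℝ≥0∞)) ^ 2 * F.J l') ?_ ?_ ?_ ?_
  · have := ENNReal.Tendsto.mul_const (b := F.J l') (tendsto_inv_iff.2 h1) (Or.inl (by simp))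
    simpa using this
  · have := ENNReal.Tendsto.mul_const (b := F.J l') h1 (Or.inl (by simp))
    simpa using this
  · intro l
    have h2 := F.J_le l' l
    rw [← nndist_eq_nnnorm, nndist_comm, nndist_eq_nnnorm] at h2
    beta_reduce
    rw [mul_comm, ← div_eq_mul_inv]
    exact ENNReal.div_le_of_le_mul' h2
  · intro l
    exact (F.J_le l l')


def G (g : R2 → ℝ) (p : R2) : E3 := F.pt p.1 p.2 (g p)

lemma G_inj (g : R2 → ℝ) : Function.Injective (F.G g) := by
  intro p q h
  obtain ⟨h1, h2, _⟩ := F.pt_inj h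
  exact Prod.ext h1 h2

lemma pt_cont : Continuous (fun q : ℝ × ℝ × ℝ => F.pt q.1 q.2.1 q.2.2) := by
  unfold pt; fun_prop

lemma G_cont {g : R2 → ℝ} (hg : Continuous g) : Continuous (F.G g) := by
  unfold G pt; fun_prop

lemma G_meas {g : R2 → ℝ} (hg : Continuous g) {s : Set R2} (hs : MeasurableSet s) :
    MeasurableSet (F.G g '' s) :=
  hs.image_of_continuousOn_injOn (F.G_cont hg).continuousOn (F.G_inj g).injOn

/-- The area formula for graphs. -/
lemma area {g : R2 → ℝ} (hg : Continuous g) {s : Set R2} (hs : MeasurableSet s)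
    (hd : ∀ p ∈ s, DifferentiableAt ℝ g p) :
    μH[2] (F.G g '' s) = ∫⁻ p in s, F.J (fderiv ℝ g p) := by
  rcases s.eq_empty_or_nonempty with rfl | hne
  · simp
  have hpart : ∀ ε : NNReal, 0 < ε → ∃ (t : ℕ → Set R2) (l : ℕ → R2 →L[ℝ] ℝ),
      Pairwise (Function.onFun Disjoint t) ∧ (∀ n, MeasurableSet (t n)) ∧ s = ⋃ n, t n ∧
      (∀ n, ∀ x ∈ t n, ∀ y ∈ t n, |g x - g y - l n (x - y)| ≤ ε * ‖x - y‖) ∧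
      (∀ n, ∀ᵐ p ∂(volume.restrict (t n)), ‖fderiv ℝ g p - l n‖₊ ≤ ε) := by
    intro ε hε
    have hder : ∀ x ∈ s, HasFDerivWithinAt (fun p => (g p, (0 : ℝ)))
        ((fderiv ℝ g x).prod (0 : R2 →L[ℝ] ℝ)) s x := fun x hx =>
      ((hd x hx).hasFDerivAt.prodMk (hasFDerivAt_const (0 : ℝ) x)).hasFDerivWithinAt
    obtain ⟨t, A, h1, h2, h3, h4, h5⟩ := exists_partition_approximatesLinearOn_of_hasFDerivWithinAt
      (fun p => (g p, (0 : ℝ))) s (fun x => (fderiv ℝ g x).prod (0 : R2 →L[ℝ] ℝ)) hder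
      (fun _ => ε) (fun _ => hε.ne')
    choose y hy hA using h5 hne
    refine ⟨fun n => s ∩ t n, fun n => fderiv ℝ g (y n), ?_, fun n => hs.inter (h2 n), ?_, ?_, ?_⟩
    · intro i j hij
      exact (h1 hij).mono inter_subset_right inter_subset_right
    · rw [← inter_iUnion, inter_eq_left.2 h3]
    · intro n p hp q hq
      have := h4 n p hp q hq
      rw [hA] at this
      refine le_trans ?_ this
      exact norm_fst_le ((g p, (0 : ℝ)) - (g q, (0 : ℝ)) -
        ((fderiv ℝ g (y n)).prod (0 : R2 →L[ℝ] ℝ)) (p - q))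
    · intro n
      have := (h4 n).norm_fderiv_sub_le volume (hs.inter (h2 n))
        (fun x => (fderiv ℝ g x).prod (0 : R2 →L[ℝ] ℝ))
        (fun x hx => (hder x hx.1).mono inter_subset_left)
      filter_upwards [this] with p hp
      refine le_trans ?_ hp
      rw [hA, ← NNReal.coe_le_coe, coe_nnnorm, coe_nnnorm]
      apply ContinuousLinearMap.opNorm_le_bound _ (norm_nonneg _)
      intro v
      refine le_trans ?_ (ContinuousLinearMap.le_opNorm _ v)
      exact norm_fst_le (((fderiv ℝ g p).prod (0 : R2 →L[ℝ] ℝ) -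
        (fderiv ℝ g (y n)).prod (0 : R2 →L[ℝ] ℝ)) v)
  apply le_antisymm
  · apply le_of_eps 4
    intro ε hε
    obtain ⟨t, l, h1, h2, h3, h4, h5⟩ := hpart ε hε
    have hsum : ∫⁻ p in s, F.J (fderiv ℝ g p) = ∑' n, ∫⁻ p in t n, F.J (fderiv ℝ g p) := by
      rw [h3, lintegral_iUnion h2 h1]
    rw [hsum, ← ENNReal.tsum_mul_left]
    conv_lhs => rw [h3]
    rw [image_iUnion]
    refine (measure_iUnion_le _).trans (ENNReal.tsum_le_tsum fun n => ?_)
    refine (F.cmp_aux (l n) g (t n) ε (h4 n)).1.trans ?_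
    have : F.J (l n) * volume (t n) ≤ (1 + (ε : ℝ≥0∞)) ^ 2 * ∫⁻ p in t n, F.J (fderiv ℝ g p) := by
      rw [← setLIntegral_const, ← lintegral_const_mul' _ _ (by finiteness)]
      apply lintegral_mono_ae
      filter_upwards [h5 n] with p hp
      refine (F.J_le (l n) (fderiv ℝ g p)).trans ?_
      rw [← nndist_eq_nnnorm, nndist_comm, nndist_eq_nnnorm]
      gcongr
    calc _ ≤ (1 + (ε : ℝ≥0∞)) ^ 2 * ((1 + (ε : ℝ≥0∞)) ^ 2 * ∫⁻ p in t n, F.J (fderiv ℝ g p)) := by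
          gcongr
      _ = _ := by ring
  · apply le_of_eps 4
    intro ε hε
    obtain ⟨t, l, h1, h2, h3, h4, h5⟩ := hpart ε hε
    have hsum : μH[2] (F.G g '' s) = ∑' n, μH[2] (F.G g '' (t n)) := by
      rw [h3, image_iUnion, measure_iUnion _ (fun n => F.G_meas hg (h2 n))]
      intro i j hij
      exact (disjoint_image_iff (F.G_inj g)).2 (h1 hij)
    rw [hsum, ← ENNReal.tsum_mul_left]
    conv_lhs => rw [h3]
    rw [lintegral_iUnion h2 h1]
    refine ENNReal.tsum_le_tsum fun n => ?_
    have h6 := (F.cmp_aux (l n) g (t n) ε (h4 n)).2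
    have : ∫⁻ p in t n, F.J (fderiv ℝ g p) ≤ (1 + (ε : ℝ≥0∞)) ^ 2 * (F.J (l n) * volume (t n)) := by
      rw [← mul_assoc, ← setLIntegral_const]
      apply lintegral_mono_ae
      filter_upwards [h5 n] with p hp
      refine (F.J_le (fderiv ℝ g p) (l n)).trans ?_
      gcongr
    refine this.trans ?_
    calc _ ≤ (1 + (ε : ℝ≥0∞)) ^ 2 * ((1 + (ε : ℝ≥0∞)) ^ 2 * μH[2] (F.G g '' (t n))) := by
          exact mul_le_mul_right h6 _
      _ = _ := by ring

/-- The projection. -/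
def π (r : E3) : R2 := (⟪r, F.τ⟫, ⟪r, F.u⟫)

lemma π_cont : Continuous F.π := by unfold π; fun_prop

lemma π_pt (y z h : ℝ) : F.π (F.pt y z h) = (y, z) := by
  simp only [π, pt, inner_add_left, inner_sub_left,
    real_inner_smul_left, F.tt, F.uu, F.bt, F.bu, F.tu, F.ut]
  simp

lemma π_G (g : R2 → ℝ) (p : R2) : F.π (F.G g p) = p := F.π_pt _ _ _

lemma area_map {g : R2 → ℝ} (hg : Continuous g) {s : Set R2} (hs : MeasurableSet s)
    (hd : ∀ p ∈ s, DifferentiableAt ℝ g p) :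
    Measure.map F.π (μH[2].restrict (F.G g '' s)) =
      (volume.restrict s).withDensity (fun p => F.J (fderiv ℝ g p)) := by
  ext E hE
  rw [Measure.map_apply F.π_cont.measurable hE, Measure.restrict_apply (F.π_cont.measurable hE),
    withDensity_apply _ hE, Measure.restrict_restrict hE]
  have : F.π ⁻¹' E ∩ F.G g '' s = F.G g '' (E ∩ s) := by
    ext r
    constructor
    · rintro ⟨h1, p, hp, rfl⟩
      rw [mem_preimage, π_G] at h1
      exact ⟨p, ⟨h1, hp⟩, rfl⟩
    · rintro ⟨p, ⟨h1, hp⟩, rfl⟩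
      exact ⟨by rw [mem_preimage, π_G]; exact h1, p, hp, rfl⟩
  rw [this, F.area hg (hE.inter hs) (fun p hp => hd p hp.2)]

end Fr

/-- Parameters of the construction. -/
structure Par where
  k : ℝ
  hk : 0 < k
  Ks : Set ℝ
  comp : IsCompact Ks
  sub : Ks ⊆ Icc (-k) k
  mem : k ∈ Ks
  mem' : -k ∈ Ks
  q : ℝ
  hq : |q| < k
  c : ℝ
  hc : 0 < c

namespace Par
variable (P : Par)

/-- The second order coefficient. -/
def w (T : ℝ) : ℝ := 2 + P.k - √(1 + T ^ 2)

lemma one_le_w {T : ℝ} (hT : T ∈ P.Ks) : 1 ≤ P.w T := by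
  have h := P.sub hT
  have h2 : √(1 + T ^ 2) ≤ 1 + P.k := by
    rw [Real.sqrt_le_left (by linarith [P.hk])]
    nlinarith [h.1, h.2, P.hk]
  unfold w; linarith

lemma w_le (T : ℝ) : P.w T ≤ 2 + P.k := by
  unfold w; linarith [Real.sqrt_nonneg (1 + T ^ 2)]

/-- The supporting functions. -/
def φ (T : ℝ) (p : R2) : ℝ := p.1 * T + p.2 ^ 2 * P.w T

/-- The function whose graph is the surface. -/
def g (p : R2) : ℝ := sSup ((fun T => P.φ T p) '' P.Ks)

lemma φ_cont (p : R2) : Continuous (fun T => P.φ T p) := by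
  unfold φ w; fun_prop

lemma φ_le {T : ℝ} (hT : T ∈ P.Ks) (p : R2) : P.φ T p ≤ P.g p :=
  le_csSup (P.comp.image (P.φ_cont p)).bddAbove ⟨T, hT, rfl⟩

lemma exists_active (p : R2) : ∃ T ∈ P.Ks, P.g p = P.φ T p :=
  P.comp.exists_sSup_image_eq ⟨_, P.mem⟩ (P.φ_cont p).continuousOn

lemma le_g (p : R2) : P.k * |p.1| + p.2 ^ 2 ≤ P.g p := by
  have h1 := P.φ_le P.mem p
  have h2 := P.φ_le P.mem' p
  have h3 := P.one_le_w P.mem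
  have h4 := P.one_le_w P.mem'
  unfold φ at h1 h2
  have h5 := mul_le_mul_of_nonneg_left h3 (sq_nonneg p.2)
  have h6 := mul_le_mul_of_nonneg_left h4 (sq_nonneg p.2)
  rcases abs_cases p.1 with h | h <;> rw [h.1] <;> nlinarith

lemma g_le (p : R2) : P.g p ≤ P.k * |p.1| + (2 + P.k) * p.2 ^ 2 := by
  obtain ⟨T, hT, h⟩ := P.exists_active p
  rw [h, φ]
  have h1 := mul_le_mul_of_nonneg_left (P.w_le T) (sq_nonneg p.2)
  have h2 : p.1 * T ≤ P.k * |p.1| := by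
    calc p.1 * T ≤ |p.1 * T| := le_abs_self _
      _ = |p.1| * |T| := abs_mul _ _
      _ ≤ |p.1| * P.k := by gcongr; exact abs_le.2 (P.sub hT)
      _ = _ := mul_comm _ _
  linarith

lemma g_zero : P.g 0 = 0 := by
  have h1 := P.le_g 0
  have h2 := P.g_le 0
  simp at h1 h2
  linarith

lemma φ_sub {T : ℝ} (hT : T ∈ P.Ks) (p p' : R2) :
    P.φ T p - P.φ T p' ≤ P.k * |p.1 - p'.1| + (2 + P.k) * |p.2 ^ 2 - p'.2 ^ 2| := by
  have h1 : (p.1 - p'.1) * T ≤ P.k * |p.1 - p'.1| := by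
    calc (p.1 - p'.1) * T ≤ |(p.1 - p'.1) * T| := le_abs_self _
      _ = |p.1 - p'.1| * |T| := abs_mul _ _
      _ ≤ |p.1 - p'.1| * P.k := by gcongr; exact abs_le.2 (P.sub hT)
      _ = _ := mul_comm _ _
  have h2 : (p.2 ^ 2 - p'.2 ^ 2) * P.w T ≤ (2 + P.k) * |p.2 ^ 2 - p'.2 ^ 2| := by
    calc (p.2 ^ 2 - p'.2 ^ 2) * P.w T ≤ |(p.2 ^ 2 - p'.2 ^ 2) * P.w T| := le_abs_self _
      _ = |p.2 ^ 2 - p'.2 ^ 2| * |P.w T| := abs_mul _ _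
      _ ≤ |p.2 ^ 2 - p'.2 ^ 2| * (2 + P.k) := by
        gcongr; exact abs_le.2 ⟨by linarith [P.one_le_w hT, P.hk], P.w_le T⟩
      _ = _ := mul_comm _ _
  unfold φ; linarith

lemma g_sub (p p' : R2) :
    P.g p - P.g p' ≤ P.k * |p.1 - p'.1| + (2 + P.k) * |p.2 ^ 2 - p'.2 ^ 2| := by
  obtain ⟨T, hT, h⟩ := P.exists_active p
  have h1 := P.φ_sub hT p p'
  have h2 := P.φ_le hT p'
  linarith

lemma g_lip (R : NNReal) : ∃ K : NNReal, LipschitzOnWith K P.g (Metric.ball 0 R) := by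
  refine ⟨⟨P.k + (2 + P.k) * (2 * R), by have := P.hk; positivity⟩, ?_⟩
  apply LipschitzOnWith.of_le_add_mul
  intro p hp p' hp'
  have h := P.g_sub p p'
  rw [mem_ball_zero_iff] at hp hp'
  have h1 : |p.1 - p'.1| ≤ dist p p' := by
    rw [dist_eq_norm]; exact norm_fst_le (p - p')
  have h2 : |p.2 - p'.2| ≤ dist p p' := by
    rw [dist_eq_norm]; exact norm_snd_le (p - p')
  have h3 : |p.2 + p'.2| ≤ 2 * R := by
    have a1 := norm_snd_le p
    have a2 := norm_snd_le p'
    rw [Real.norm_eq_abs] at a1 a2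
    linarith [abs_add_le p.2 p'.2]
  have h4 : |p.2 ^ 2 - p'.2 ^ 2| ≤ (2 * R) * dist p p' := by
    rw [sq_sub_sq, abs_mul]; gcongr
  have hk := P.hk
  have h5 := mul_le_mul_of_nonneg_left h1 hk.le
  have h6 := mul_le_mul_of_nonneg_left h4 (by linarith : 0 ≤ 2 + P.k)
  show _ ≤ P.g p' + (P.k + (2 + P.k) * (2 * R)) * dist p p'
  nlinarith

lemma g_cont : Continuous P.g := by
  rw [continuous_iff_continuousAt]
  intro p
  obtain ⟨K, hK⟩ := P.g_lip (‖p‖₊ + 1)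
  exact hK.continuousOn.continuousAt (Metric.isOpen_ball.mem_nhds (by simp))

/-- The anisotropic scaling. -/
def S (s : ℝ) (hs : s ≠ 0) : R2 ≃L[ℝ] R2 :=
  ContinuousLinearEquiv.prodCongr
    (ContinuousLinearEquiv.unitsEquivAut ℝ (Units.mk0 (s ^ 2) (pow_ne_zero 2 hs)))
    (ContinuousLinearEquiv.unitsEquivAut ℝ (Units.mk0 s hs))

lemma S_apply (s : ℝ) (hs : s ≠ 0) (p : R2) : S s hs p = (s ^ 2 * p.1, s * p.2) := by
  simp [S, mul_comm]

lemma g_S (s : ℝ) (hs : s ≠ 0) (p : R2) : P.g (S s hs p) = s ^ 2 * P.g p := by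
  have key : ∀ T, P.φ T (S s hs p) = s ^ 2 * P.φ T p := by
    intro T; rw [S_apply]; simp only [φ]; ring
  apply le_antisymm
  · obtain ⟨T, hT, h⟩ := P.exists_active (S s hs p)
    rw [h, key]
    exact mul_le_mul_of_nonneg_left (P.φ_le hT p) (sq_nonneg s)
  · obtain ⟨T, hT, h⟩ := P.exists_active p
    rw [h, ← key]
    exact P.φ_le hT _

/-- The limiting squeeze. -/
def Rs (s : ℝ) : R2 →L[ℝ] R2 :=
  (ContinuousLinearMap.fst ℝ ℝ ℝ).prod (s • ContinuousLinearMap.snd ℝ ℝ ℝ)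

lemma Rs_apply (s : ℝ) (p : R2) : Rs s p = (p.1, s * p.2) := by simp [Rs]

lemma Rs_cont : Continuous Rs := by
  have : Rs = fun s => (ContinuousLinearMap.inl ℝ ℝ ℝ).comp (ContinuousLinearMap.fst ℝ ℝ ℝ) +
    s • (ContinuousLinearMap.inr ℝ ℝ ℝ).comp (ContinuousLinearMap.snd ℝ ℝ ℝ) := by
    funext s; ext <;> simp [Rs]
  rw [this]; fun_prop

lemma fderiv_S (s : ℝ) (hs : s ≠ 0) (p : R2) :
    fderiv ℝ P.g (S s hs p) = (fderiv ℝ P.g p).comp (Rs s) := by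
  have h1 : fderiv ℝ (P.g ∘ S s hs) p = s ^ 2 • fderiv ℝ P.g p := by
    have : P.g ∘ S s hs = fun p => s ^ 2 • P.g p := by
      funext p; exact P.g_S s hs p
    rw [this]
    exact congrFun (fderiv_const_smul_field (f := P.g) (s ^ 2)) p
  rw [(S s hs).comp_right_fderiv] at h1
  apply ContinuousLinearMap.ext
  intro v
  have h2 := congrArg (fun L : R2 →L[ℝ] ℝ => L (v.1 / s ^ 2, v.2 / s)) h1
  have h3 : S s hs (v.1 / s ^ 2, v.2 / s) = v := by
    rw [S_apply]; ext <;> simp only <;> field_simp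
  have h4 : s ^ 2 • ((v.1 / s ^ 2, v.2 / s) : R2) = Rs s v := by
    rw [Rs_apply]; ext <;> simp only [Prod.smul_mk, smul_eq_mul] <;> field_simp
  simp only [ContinuousLinearMap.comp_apply, ContinuousLinearEquiv.coe_coe, h3, smul_apply] at h2
  rw [h2, ContinuousLinearMap.comp_apply, ← h4, map_smul]

/-- The derivative of `φ`. -/
def dφ (T : ℝ) (p : R2) : R2 →L[ℝ] ℝ :=
  T • ContinuousLinearMap.fst ℝ ℝ ℝ + (2 * p.2 * P.w T) • ContinuousLinearMap.snd ℝ ℝ ℝ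

lemma dφ_apply (T : ℝ) (p v : R2) : P.dφ T p v = T * v.1 + 2 * p.2 * P.w T * v.2 := by
  simp [dφ]

lemma φ_hasFDerivAt (T : ℝ) (p : R2) : HasFDerivAt (P.φ T) (P.dφ T p) p := by
  have h1 : HasFDerivAt (fun p : R2 => p.1 * T) (T • ContinuousLinearMap.fst ℝ ℝ ℝ) p :=
    hasFDerivAt_fst.mul_const T
  have h2 : HasFDerivAt (fun p : R2 => p.2 ^ 2 * P.w T)
      (P.w T • ((2 * p.2) • ContinuousLinearMap.snd ℝ ℝ ℝ)) p := by
    simpa using (hasFDerivAt_snd (p := p)).pow 2 |>.mul_const (P.w T)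
  refine (h1.add h2).congr_fderiv ?_
  ext <;> simp [dφ]; ring

lemma fderiv_eq {p : R2} (hp : DifferentiableAt ℝ P.g p) {T : ℝ} (hT : T ∈ P.Ks)
    (h : P.g p = P.φ T p) : fderiv ℝ P.g p = P.dφ T p := by
  have hmin : IsLocalMin (fun x => P.g x - P.φ T x) p := by
    apply Filter.Eventually.of_forall
    intro x
    have := P.φ_le hT x
    simp only
    linarith
  have h1 := hmin.hasFDerivAt_eq_zero (hp.hasFDerivAt.sub (P.φ_hasFDerivAt T p))
  exact sub_eq_zero.1 h1

lemma g_tangent {p : R2} (hp : DifferentiableAt ℝ P.g p) (x : R2) :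
    P.g p + fderiv ℝ P.g p (x - p) ≤ P.g x := by
  obtain ⟨T, hT, h⟩ := P.exists_active p
  rw [P.fderiv_eq hp hT h, h, dφ_apply]
  refine le_trans ?_ (P.φ_le hT x)
  have h1 := P.one_le_w hT
  simp only [φ, Prod.fst_sub, Prod.snd_sub]
  nlinarith [mul_nonneg (sq_nonneg (x.2 - p.2)) (by linarith : 0 ≤ P.w T)]

/-- The base region. -/
def A (t : ℝ) : Set R2 := {p | P.g p - P.q * p.1 ≤ t}

lemma A_closed (t : ℝ) : IsClosed (P.A t) :=
  isClosed_le (by have := P.g_cont; fun_prop) continuous_const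

lemma A_bound {t : ℝ} {p : R2} (hp : p ∈ P.A t) : (P.k - |P.q|) * |p.1| + p.2 ^ 2 ≤ t := by
  have h1 := P.le_g p
  have h2 : P.q * p.1 ≤ |P.q| * |p.1| := by rw [← abs_mul]; exact le_abs_self _
  have h3 : P.g p - P.q * p.1 ≤ t := hp
  linarith

lemma A_ball (t : ℝ) : ∃ R : NNReal, P.A t ⊆ Metric.ball 0 R := by
  have hd : 0 < P.k - |P.q| := by linarith [P.hq]
  refine ⟨⟨|t| / (P.k - |P.q|) + |t| + 2, by positivity⟩, fun p hp => ?_⟩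
  have h := P.A_bound hp
  rw [mem_ball_zero_iff, Prod.norm_def, Real.norm_eq_abs, Real.norm_eq_abs]
  have ht := le_abs_self t
  have h0 : 0 ≤ |t| / (P.k - |P.q|) := by positivity
  apply max_lt
  · have : |p.1| ≤ |t| / (P.k - |P.q|) := by
      rw [le_div_iff₀ hd]; nlinarith [sq_nonneg p.2]
    show _ < |t| / (P.k - |P.q|) + |t| + 2
    linarith [abs_nonneg t]
  · show _ < |t| / (P.k - |P.q|) + |t| + 2
    have h2 : |p.2| ^ 2 ≤ |t| := by
      rw [sq_abs]; nlinarith [mul_nonneg hd.le (abs_nonneg p.1)]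
    nlinarith [abs_nonneg p.2, abs_nonneg t]

lemma A_S (s : ℝ) (hs : s ≠ 0) (t : ℝ) : (S s hs) ⁻¹' (P.A (s ^ 2 * t)) = P.A t := by
  ext p
  show P.g (S s hs p) - P.q * (S s hs p).1 ≤ s ^ 2 * t ↔ P.g p - P.q * p.1 ≤ t
  rw [P.g_S, S_apply]
  have : 0 < s ^ 2 := by positivity
  rw [show s ^ 2 * P.g p - P.q * (s ^ 2 * p.1, s * p.2).1 = s ^ 2 * (P.g p - P.q * p.1) by ring,
    mul_le_mul_iff_right₀ this]

lemma A_mono {t t' : ℝ} (h : t ≤ t') : P.A t ⊆ P.A t' := fun p hp => le_trans (show _ ≤ t from hp) h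

lemma A_vol_pos {t : ℝ} (ht : 0 < t) : 0 < volume (P.A t) := by
  have ho : IsOpen {p : R2 | P.g p - P.q * p.1 < t} :=
    isOpen_lt (by have := P.g_cont; fun_prop) continuous_const
  refine (ho.measure_pos volume ⟨0, ?_⟩).trans_le (measure_mono fun p (hp : _ < t) => hp.le)
  simp [P.g_zero, ht]

lemma A_vol_lt (t : ℝ) : volume (P.A t) < ⊤ := by
  obtain ⟨R, hR⟩ := P.A_ball t
  exact (measure_mono hR).trans_lt measure_ball_lt_top

/-- The differentiability set. -/
def D : Set R2 := {p | DifferentiableAt ℝ P.g p}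

lemma D_meas : MeasurableSet P.D := measurableSet_of_differentiableAt ℝ P.g

lemma D_ae (t : ℝ) : volume (P.A t \ P.D) = 0 := by
  obtain ⟨R, hR⟩ := P.A_ball t
  obtain ⟨K, hK⟩ := P.g_lip R
  have h1 := hK.ae_differentiableWithinAt (μ := volume) Metric.isOpen_ball.measurableSet
  rw [ae_restrict_iff' Metric.isOpen_ball.measurableSet, ae_iff] at h1
  refine measure_mono_null ?_ h1
  intro p hp h
  exact hp.2 ((h (hR hp.1)).differentiableAt (Metric.isOpen_ball.mem_nhds (hR hp.1)))

lemma fderiv_bound (t : ℝ) : ∃ K : ℝ, ∀ p ∈ P.A t, ‖fderiv ℝ P.g p‖ ≤ K := by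
  obtain ⟨R, hR⟩ := P.A_ball t
  obtain ⟨K, hK⟩ := P.g_lip R
  exact ⟨K, fun p hp => norm_fderiv_le_of_lipschitzOn ℝ (Metric.isOpen_ball.mem_nhds (hR hp)) hK⟩

end Par

namespace Fr
variable (F : Fr)

lemma hh_pt (y z h : ℝ) : -⟪F.pt y z h, F.b⟫ = h := by
  simp only [pt, inner_add_left, inner_sub_left, real_inner_smul_left, F.bb, F.tb, F.ub]
  simp

lemma pt_comb (a a' y z h y' z' h' : ℝ) : a • F.pt y z h + a' • F.pt y' z' h' =
    F.pt (a * y + a' * y') (a * z + a' * z') (a * h + a' * h') := by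
  simp only [pt]; module

lemma smul_pt (a y z h : ℝ) : a • F.pt y z h = F.pt (a * y) (a * z) (a * h) := by
  simp only [pt]; module

lemma pt_zero : F.pt 0 0 0 = 0 := by simp [pt]

end Fr

/-- The convex body. -/
def body (F : Fr) (P : Par) : Set E3 :=
  {r | P.g (F.π r) ≤ -⟪r, F.b⟫ ∧ -⟪r, F.b⟫ - P.q * (F.π r).1 ≤ 1 / P.c}

/-- The cutting direction. -/
def dir (F : Fr) (P : Par) : E3 := F.pt (P.c * P.q) 0 (-P.c)

section
variable (F : Fr) (P : Par)

lemma mem_body (y z h : ℝ) :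
    F.pt y z h ∈ body F P ↔ P.g (y, z) ≤ h ∧ h - P.q * y ≤ 1 / P.c := by
  show P.g (F.π (F.pt y z h)) ≤ -⟪F.pt y z h, F.b⟫ ∧
    -⟪F.pt y z h, F.b⟫ - P.q * (F.π (F.pt y z h)).1 ≤ 1 / P.c ↔ _
  rw [F.hh_pt, F.π_pt]

lemma inner_dir (y z h : ℝ) : ⟪F.pt y z h, dir F P⟫ = -(P.c * (h - P.q * y)) := by
  rw [dir, F.inner_pt]; ring

lemma body_closed : IsClosed (body F P) := by
  have h1 := P.g_cont
  have h2 := F.π_cont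
  have a1 : Continuous (fun r : E3 => P.g (F.π r)) := h1.comp h2
  have a2 : Continuous (fun r : E3 => -⟪r, F.b⟫) := by fun_prop
  have a3 : Continuous (fun r : E3 => -⟪r, F.b⟫ - P.q * (F.π r).1) := by fun_prop
  exact (isClosed_le a1 a2).inter (isClosed_le a3 continuous_const)

/-- The open part of the body. -/
lemma mem_int {y z h : ℝ} (h1 : P.g (y, z) < h) (h2 : h - P.q * y < 1 / P.c) :
    F.pt y z h ∈ interior (body F P) := by
  have ho : IsOpen {r : E3 | P.g (F.π r) < -⟪r, F.b⟫ ∧ -⟪r, F.b⟫ - P.q * (F.π r).1 < 1 / P.c} := by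
    have h1 := P.g_cont
    have h2 := F.π_cont
    have a1 : Continuous (fun r : E3 => P.g (F.π r)) := h1.comp h2
    have a2 : Continuous (fun r : E3 => -⟪r, F.b⟫) := by fun_prop
    have a3 : Continuous (fun r : E3 => -⟪r, F.b⟫ - P.q * (F.π r).1) := by fun_prop
    exact (isOpen_lt a1 a2).inter (isOpen_lt a3 continuous_const)
  refine mem_interior.2 ⟨_, fun r hr => ⟨hr.1.le, hr.2.le⟩, ho, ?_⟩
  show P.g (F.π (F.pt y z h)) < -⟪F.pt y z h, F.b⟫ ∧
    -⟪F.pt y z h, F.b⟫ - P.q * (F.π (F.pt y z h)).1 < 1 / P.c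
  rw [F.hh_pt, F.π_pt]
  exact ⟨h1, h2⟩

lemma not_mem_int (p : R2) : F.G P.g p ∉ interior (body F P) := by
  intro h
  rw [mem_interior_iff_mem_nhds] at h
  have hc : Continuous (fun δ : ℝ => F.pt p.1 p.2 (P.g p - δ)) := by unfold Fr.pt; fun_prop
  have h1 : Tendsto (fun δ : ℝ => F.pt p.1 p.2 (P.g p - δ)) (𝓝[>] 0) (𝓝 (F.G P.g p)) := by
    have := hc.tendsto 0
    simp only [sub_zero] at this
    exact this.mono_left nhdsWithin_le_nhds
  have h2 := (h1.eventually h).and (self_mem_nhdsWithin : Ioi (0 : ℝ) ∈ 𝓝[>] 0)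
  obtain ⟨δ, h3, h4⟩ := h2.exists
  have h5 := ((mem_body F P _ _ _).1 h3).1
  have h6 : 0 < δ := h4
  have h7 : P.g p ≤ P.g p - δ := h5
  linarith

lemma body_convexBody : IsConvexBody (body F P) := by
  refine ⟨?_, ?_, ?_⟩
  · refine Metric.isCompact_of_isClosed_isBounded (body_closed F P) ?_
    obtain ⟨R, hR⟩ := P.A_ball (1 / P.c)
    rw [isBounded_iff_forall_norm_le]
    refine ⟨2 * R + (1 / P.c + P.k * R), fun r hr => ?_⟩
    obtain ⟨y, z, h, rfl⟩ := F.pt_surj r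
    obtain ⟨h1, h2⟩ := (mem_body F P _ _ _).1 hr
    have h3 : ((y, z) : R2) ∈ P.A (1 / P.c) := by
      show P.g (y, z) - P.q * y ≤ _
      linarith
    have h4 := hR h3
    rw [mem_ball_zero_iff] at h4
    refine (F.norm_pt_le (y, z) h).trans ?_
    have h5 := P.le_g (y, z)
    have hy : |y| ≤ R := (norm_fst_le ((y, z) : R2)).trans h4.le
    have hk := P.hk
    have h6 : 0 ≤ h := by
      refine le_trans ?_ h1
      refine le_trans ?_ h5
      positivity
    have h7 : P.q * y ≤ P.k * R := by
      calc P.q * y ≤ |P.q * y| := le_abs_self _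
        _ = |P.q| * |y| := abs_mul _ _
        _ ≤ P.k * R := by gcongr; exact P.hq.le
    rw [abs_of_nonneg h6]
    linarith
  · intro r hr r' hr' a a' ha ha' haa
    obtain ⟨y, z, h, rfl⟩ := F.pt_surj r
    obtain ⟨y', z', h', rfl⟩ := F.pt_surj r'
    obtain ⟨h1, h2⟩ := (mem_body F P _ _ _).1 hr
    obtain ⟨h1', h2'⟩ := (mem_body F P _ _ _).1 hr'
    rw [F.pt_comb, mem_body]
    constructor
    · obtain ⟨T, hT, hg⟩ := P.exists_active (a * y + a' * y', a * z + a' * z')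
      rw [hg]
      have h3 := mul_le_mul_of_nonneg_left ((P.φ_le hT (y, z)).trans h1) ha
      have h4 := mul_le_mul_of_nonneg_left ((P.φ_le hT (y', z')).trans h1') ha'
      refine le_trans ?_ (add_le_add h3 h4)
      simp only [Par.φ]
      have h5 : (a * z + a' * z') ^ 2 ≤ a * z ^ 2 + a' * z' ^ 2 := by
        have : a' = 1 - a := by linarith
        subst this
        nlinarith [mul_nonneg (mul_nonneg ha ha') (sq_nonneg (z - z'))]
      have h6 := mul_le_mul_of_nonneg_right h5 (by linarith [P.one_le_w hT] : 0 ≤ P.w T)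
      linarith
    · have h3 := mul_le_mul_of_nonneg_left h2 ha
      have h4 := mul_le_mul_of_nonneg_left h2' ha'
      have h5 : a * (1 / P.c) + a' * (1 / P.c) = 1 / P.c := by rw [← add_mul, haa, one_mul]
      linarith
  · refine ⟨F.pt 0 0 (1 / P.c / 2), mem_int F P ?_ ?_⟩
    · have := P.g_zero
      have hc := P.hc
      rw [show ((0, 0) : R2) = 0 from rfl, this]; positivity
    · have : 0 < 1 / P.c := by have hc := P.hc; positivity
      linarith

lemma S_eq {t : ℝ} (ht1 : t < 1) :
    Sset (body F P) 0 (dir F P) t = F.G P.g '' (P.A (t / P.c)) := by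
  have hc := P.hc
  have hlt : t / P.c < 1 / P.c := by gcongr
  ext r
  constructor
  · rintro ⟨h1, h2⟩
    have hr : r ∈ body F P := (body_closed F P).frontier_subset h1
    obtain ⟨y, z, h, rfl⟩ := F.pt_surj r
    have h2' : ⟪F.pt y z h - 0, dir F P⟫ ≥ -t := h2
    rw [sub_zero, inner_dir] at h2'
    have h3 : h - P.q * y ≤ t / P.c := by
      rw [le_div_iff₀ hc]; linarith
    obtain ⟨h4, h5⟩ := (mem_body F P _ _ _).1 hr
    have h6 : P.g (y, z) = h := by
      apply le_antisymm h4
      by_contra hcon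
      exact h1.2 (mem_int F P (not_le.1 hcon) (by linarith))
    refine ⟨(y, z), ?_, ?_⟩
    · show P.g (y, z) - P.q * y ≤ _
      rw [h6]; exact h3
    · rw [Fr.G, h6]
  · rintro ⟨p, hp, rfl⟩
    have hp' : P.g p - P.q * p.1 ≤ t / P.c := hp
    refine ⟨⟨subset_closure ((mem_body F P _ _ _).2 ⟨le_refl _, by linarith⟩), not_mem_int F P p⟩, ?_⟩
    show ⟪F.pt p.1 p.2 (P.g p) - 0, dir F P⟫ ≥ -t
    rw [sub_zero, inner_dir]
    rw [le_div_iff₀ hc] at hp'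
    linarith

lemma zero_frontier : (0 : E3) ∈ frontier (body F P) := by
  have h : (0 : E3) ∈ Sset (body F P) 0 (dir F P) 0 := by
    rw [S_eq F P one_pos]
    refine ⟨0, ?_, ?_⟩
    · show P.g 0 - P.q * 0 ≤ 0 / P.c
      rw [P.g_zero]; simp
    · rw [Fr.G, P.g_zero]; exact F.pt_zero
  exact h.1

/-- The slope of the cutting plane. -/
def slopeB : R2 →L[ℝ] ℝ := P.q • ContinuousLinearMap.fst ℝ ℝ ℝ

lemma B_meas {t : ℝ} (ht1 : t < 1) :
    μH[2] (Bset (body F P) 0 (dir F P) t) = F.J (slopeB P) * volume (P.A (t / P.c)) := by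
  have hc := P.hc
  have hlt : t / P.c < 1 / P.c := by gcongr
  have : Bset (body F P) 0 (dir F P) t =
      (fun x => F.pt 0 0 (t / P.c) + x) '' (F.L (slopeB P) '' (P.A (t / P.c))) := by
    ext r
    rw [image_image]
    have hpt : ∀ p : R2, F.pt 0 0 (t / P.c) + F.L (slopeB P) p =
        F.pt p.1 p.2 (t / P.c + P.q * p.1) := by
      intro p
      rw [F.L_apply]; simp only [Fr.pt, slopeB, smul_apply, ContinuousLinearMap.coe_fst', smul_eq_mul]
      module
    constructor
    · rintro ⟨h1, h2⟩
      obtain ⟨y, z, h, rfl⟩ := F.pt_surj r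
      have h2' : ⟪F.pt y z h - 0, dir F P⟫ = -t := h2
      rw [sub_zero, inner_dir] at h2'
      have h3 : h = t / P.c + P.q * y := by
        field_simp; linarith
      obtain ⟨h4, h5⟩ := (mem_body F P _ _ _).1 h1
      refine ⟨(y, z), ?_, ?_⟩
      · show P.g (y, z) - P.q * y ≤ _
        linarith
      · simp only [hpt]; rw [h3]
    · rintro ⟨p, hp, rfl⟩
      have hp' : P.g p - P.q * p.1 ≤ t / P.c := hp
      simp only [hpt]
      refine ⟨(mem_body F P _ _ _).2 ⟨?_, by linarith⟩, ?_⟩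
      · show P.g p ≤ _
        linarith
      · show ⟪F.pt p.1 p.2 (t / P.c + P.q * p.1) - 0, dir F P⟫ = -t
        rw [sub_zero, inner_dir]; field_simp; ring
  rw [this, (isometry_add_left _).hausdorffMeasure_image (Or.inl (by norm_num)), F.L_image]

/-- The unit normal of a graph of slope `l`. -/
def Nv (l : R2 →L[ℝ] ℝ) : E3 :=
  ‖F.pt (l (1, 0)) (l (0, 1)) (-1)‖⁻¹ • F.pt (l (1, 0)) (l (0, 1)) (-1)

lemma Nv_pos (a a' : ℝ) : 0 < ‖F.pt a a' (-1)‖ := by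
  have := F.norm_pt_sq a a' (-1)
  by_contra h
  have h0 : ‖F.pt a a' (-1)‖ = 0 := le_antisymm (not_lt.1 h) (norm_nonneg _)
  rw [h0] at this
  nlinarith [sq_nonneg a, sq_nonneg a']

lemma Nv_cont : Continuous (Nv F) := by
  unfold Nv
  have : Continuous (fun l : R2 →L[ℝ] ℝ => F.pt (l (1, 0)) (l (0, 1)) (-1)) := by
    unfold Fr.pt; fun_prop
  exact (this.norm.inv₀ (fun l => (Nv_pos F _ _).ne')).smul this

lemma l_apply (l : R2 →L[ℝ] ℝ) (v : R2) : l v = v.1 * l (1, 0) + v.2 * l (0, 1) := by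
  have : v = v.1 • ((1, 0) : R2) + v.2 • ((0, 1) : R2) := by ext <;> simp
  conv_lhs => rw [this]
  rw [map_add, map_smul, map_smul]; rfl

lemma onormal_iff {p : R2} (hp : p ∈ P.D) (hA : P.g p - P.q * p.1 < 1 / P.c) (n : E3) :
    IsOutwardNormalAt (body F P) (F.G P.g p) n ↔ n = Nv F (fderiv ℝ P.g p) := by
  set l := fderiv ℝ P.g p with hl
  have hpos := Nv_pos F (l (1, 0)) (l (0, 1))
  constructor
  · rintro ⟨hn, h⟩
    obtain ⟨n1, n2, n3, rfl⟩ := F.pt_surj n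
    have hder : HasFDerivAt (fun x : R2 => n1 * (x.1 - p.1) + n2 * (x.2 - p.2) + n3 * (P.g x - P.g p))
        (n1 • ContinuousLinearMap.fst ℝ ℝ ℝ + n2 • ContinuousLinearMap.snd ℝ ℝ ℝ + n3 • l) p := by
      have a1 : HasFDerivAt (fun x : R2 => n1 * (x.1 - p.1)) (n1 • ContinuousLinearMap.fst ℝ ℝ ℝ) p :=
        (hasFDerivAt_fst.sub_const p.1).const_mul n1
      have a2 : HasFDerivAt (fun x : R2 => n2 * (x.2 - p.2)) (n2 • ContinuousLinearMap.snd ℝ ℝ ℝ) p :=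
        (hasFDerivAt_snd.sub_const p.2).const_mul n2
      have a3 : HasFDerivAt (fun x : R2 => n3 * (P.g x - P.g p)) (n3 • l) p :=
        (DifferentiableAt.hasFDerivAt (show DifferentiableAt ℝ P.g p from hp)).sub_const (P.g p)
          |>.const_mul n3
      exact (a1.add a2).add a3
    have hmax : IsLocalMax
        (fun x : R2 => n1 * (x.1 - p.1) + n2 * (x.2 - p.2) + n3 * (P.g x - P.g p)) p := by
      have ho : IsOpen {x : R2 | P.g x - P.q * x.1 < 1 / P.c} :=
        isOpen_lt (by have := P.g_cont; fun_prop) continuous_const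
      filter_upwards [ho.mem_nhds (show p ∈ _ from hA)] with x hx
      have hx' : P.g x - P.q * x.1 < 1 / P.c := hx
      have := h (F.G P.g x) ((mem_body F P _ _ _).2 ⟨le_refl _, hx'.le⟩)
      rw [Fr.G, Fr.G, F.pt_sub, F.inner_pt] at this
      simp only [sub_self, mul_zero, add_zero]
      linarith
    have h0 := hmax.hasFDerivAt_eq_zero hder
    have e1 : n1 + n3 * l (1, 0) = 0 := by
      simpa using congrArg (fun L : R2 →L[ℝ] ℝ => L (1, 0)) h0
    have e2 : n2 + n3 * l (0, 1) = 0 := by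
      simpa using congrArg (fun L : R2 →L[ℝ] ℝ => L (0, 1)) h0
    have h3 : n3 ≤ 0 := by
      have := h (F.pt p.1 p.2 (1 / P.c + P.q * p.1)) ((mem_body F P _ _ _).2
        ⟨by show P.g p ≤ _; linarith, by linarith⟩)
      rw [Fr.G, F.pt_sub, F.inner_pt] at this
      by_contra hcon
      have h4 : 0 < (1 / P.c + P.q * p.1 - P.g p) * n3 := mul_pos (by linarith) (not_le.1 hcon)
      simp only [sub_self, zero_mul, zero_add] at this
      linarith
    have e3 : F.pt n1 n2 n3 = (-n3) • F.pt (l (1, 0)) (l (0, 1)) (-1) := by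
      rw [F.smul_pt]; congr 1 <;> linarith
    rw [e3, norm_smul, Real.norm_of_nonneg (by linarith)] at hn
    rw [e3, Nv]
    congr 1
    exact eq_inv_of_mul_eq_one_left hn
  · rintro rfl
    refine ⟨?_, ?_⟩
    · rw [Nv, norm_smul, norm_inv, norm_norm, inv_mul_cancel₀ hpos.ne']
    · intro x hx
      obtain ⟨y, z, h, rfl⟩ := F.pt_surj x
      obtain ⟨h1, -⟩ := (mem_body F P _ _ _).1 hx
      rw [Nv, real_inner_smul_right, Fr.G, F.pt_sub, F.inner_pt]
      apply mul_nonpos_of_nonneg_of_nonpos (inv_nonneg.2 (norm_nonneg _))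
      have h2 := P.g_tangent hp (y, z)
      rw [← hl, l_apply] at h2
      simp only [Prod.fst_sub, Prod.snd_sub] at h2
      linarith

lemma normalMap_eq {p : R2} (hp : p ∈ P.D) (hA : P.g p - P.q * p.1 < 1 / P.c) :
    normalMap (body F P) (F.G P.g p) = Nv F (fderiv ℝ P.g p) := by
  have h : ∃ n : E3, IsOutwardNormalAt (body F P) (F.G P.g p) n :=
    ⟨_, (onormal_iff F P hp hA _).2 rfl⟩
  rw [normalMap, dif_pos h]
  exact (onormal_iff F P hp hA _).1 h.choose_spec

lemma regular {p : R2} (hp : p ∈ P.D) (hA : P.g p - P.q * p.1 < 1 / P.c) :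
    IsRegularPt (body F P) (F.G P.g p) :=
  ⟨_, (onormal_iff F P hp hA _).2 rfl, fun _ h => (onormal_iff F P hp hA _).1 h⟩

end

section
variable (F : Fr) (P : Par)

lemma mem_dihedral {κ : ℝ} (hκ : 0 < κ) (y z h : ℝ) :
    F.pt y z h ∈ dihedral (κ • F.pt P.k 0 (-1)) (κ • F.pt (-P.k) 0 (-1)) ↔ P.k * |y| ≤ h := by
  show ⟪F.pt y z h, κ • F.pt P.k 0 (-1)⟫ ≤ 0 ∧ ⟪F.pt y z h, κ • F.pt (-P.k) 0 (-1)⟫ ≤ 0 ↔ _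
  rw [real_inner_smul_right, real_inner_smul_right, F.inner_pt, F.inner_pt]
  have e : ∀ x : ℝ, κ * x ≤ 0 ↔ x ≤ 0 := fun x => by
    constructor
    · intro h; by_contra hc; have := mul_pos hκ (not_le.1 hc); linarith
    · intro h; exact mul_nonpos_of_nonneg_of_nonpos hκ.le h
  rw [e, e]
  have hk := P.hk
  constructor
  · rintro ⟨h1, h2⟩
    rcases abs_cases y with h | h <;> rw [h.1] <;> nlinarith
  · intro h1
    have h2 := mul_le_mul_of_nonneg_left (le_abs_self y) hk.le
    have h3 := mul_le_mul_of_nonneg_left (neg_abs_le y) hk.le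
    constructor <;> nlinarith

lemma tanCone_body {κ : ℝ} (hκ : 0 < κ) :
    tanCone (body F P) 0 = dihedral (κ • F.pt P.k 0 (-1)) (κ • F.pt (-P.k) 0 (-1)) := by
  have hk := P.hk
  have hcl : IsClosed (dihedral (κ • F.pt P.k 0 (-1)) (κ • F.pt (-P.k) 0 (-1))) := by
    have a1 : ∀ e : E3, Continuous (fun v : E3 => ⟪v, e⟫) := fun e => by fun_prop
    exact (isClosed_le (a1 _) continuous_const).inter (isClosed_le (a1 _) continuous_const)
  apply subset_antisymm
  · apply closure_minimal _ hcl
    rintro v ⟨c, r, hr, hc, rfl⟩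
    obtain ⟨y, z, h, rfl⟩ := F.pt_surj r
    rw [sub_zero, F.smul_pt c y z h, mem_dihedral F P hκ]
    have h1 := ((mem_body F P _ _ _).1 hr).1
    have h2 := P.le_g (y, z)
    rw [abs_mul, abs_of_nonneg hc]
    have h3 : P.k * |y| ≤ h := by
      simp only at h2
      nlinarith [sq_nonneg z]
    nlinarith
  · intro v hv
    obtain ⟨y, z, h, rfl⟩ := F.pt_surj v
    rw [mem_dihedral F P hκ] at hv
    have hc : Continuous (fun δ : ℝ => F.pt y z (h + δ)) := by unfold Fr.pt; fun_prop
    have h1 : Tendsto (fun δ : ℝ => F.pt y z (h + δ)) (𝓝[>] 0) (𝓝 (F.pt y z h)) := by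
      have := hc.tendsto 0
      simp only [add_zero] at this
      exact this.mono_left nhdsWithin_le_nhds
    refine mem_closure_of_tendsto h1 ?_
    filter_upwards [self_mem_nhdsWithin] with δ hδ
    have hδ' : 0 < δ := hδ
    have t1 : Tendsto (fun a : ℝ => (2 + P.k) * a * z ^ 2) (𝓝[>] 0) (𝓝 0) := by
      have : Continuous (fun a : ℝ => (2 + P.k) * a * z ^ 2) := by fun_prop
      have := this.tendsto 0
      simp only [mul_zero, zero_mul] at this
      exact this.mono_left nhdsWithin_le_nhds
    have t2 : Tendsto (fun a : ℝ => a * (h + δ) - P.q * (a * y)) (𝓝[>] 0) (𝓝 0) := by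
      have : Continuous (fun a : ℝ => a * (h + δ) - P.q * (a * y)) := by fun_prop
      have := this.tendsto 0
      simp only [mul_zero, zero_mul, sub_zero] at this
      exact this.mono_left nhdsWithin_le_nhds
    have hcc : 0 < 1 / P.c := by have := P.hc; positivity
    obtain ⟨a, ⟨h3, h4⟩, h5⟩ := (((t1.eventually (gt_mem_nhds hδ')).and
      (t2.eventually (gt_mem_nhds hcc))).and (self_mem_nhdsWithin : Ioi (0 : ℝ) ∈ 𝓝[>] 0)).exists
    have ha : 0 < a := h5
    refine ⟨a⁻¹, F.pt (a * y) (a * z) (a * (h + δ)), (mem_body F P _ _ _).2 ⟨?_, h4.le⟩,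
      by positivity, ?_⟩
    · refine (P.g_le _).trans ?_
      simp only
      rw [abs_mul, abs_of_pos ha]
      have h6 := mul_le_mul_of_nonneg_left hv ha.le
      have h7 := mul_le_mul_of_nonneg_left h3.le ha.le
      nlinarith
    · rw [sub_zero, F.smul_pt]
      congr 1 <;> field_simp

lemma G_null {t : ℝ} {s : Set R2} (hs : s ⊆ P.A t) (h0 : volume s = 0) : μH[2] (F.G P.g '' s) = 0 := by
  obtain ⟨R, hR⟩ := P.A_ball t
  obtain ⟨K, hK⟩ := P.g_lip R
  have := hcmp (F.G P.g) (id : R2 → R2) s (2 + K) (fun x hx y hy => by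
    rw [dist_eq_norm, dist_eq_norm, Fr.G, Fr.G, F.pt_sub]
    have h1 := F.norm_pt_le (x - y) (P.g x - P.g y)
    have h2 := hK.dist_le_mul x (hR (hs hx)) y (hR (hs hy))
    rw [Real.dist_eq, dist_eq_norm] at h2
    push_cast
    simp only [Prod.fst_sub, Prod.snd_sub] at h1
    simp only [id]
    linarith)
  rw [image_id, hausdorffMeasure_prod_real, h0, mul_zero] at this
  exact le_antisymm this zero_le

lemma measurable_Nf : Measurable (fun p => Nv F (fderiv ℝ P.g p)) :=
  (Nv_cont F).measurable.comp (measurable_fderiv ℝ P.g)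

lemma measurable_Jf : Measurable (fun p => F.J (fderiv ℝ P.g p)) :=
  F.J_cont.measurable.comp (measurable_fderiv ℝ P.g)

lemma nu_map {t : ℝ} (ht1 : t < 1) :
    Measure.map (normalMap (body F P)) (μH[2].restrict
      (Sset (body F P) 0 (dir F P) t ∩ {r : E3 | IsRegularPt (body F P) r})) =
    Measure.map (fun p => Nv F (fderiv ℝ P.g p))
      ((volume.restrict (P.A (t / P.c))).withDensity (fun p => F.J (fderiv ℝ P.g p))) := by
  have hc := P.hc
  have hlt : t / P.c < 1 / P.c := by gcongr
  have hAm := (P.A_closed (t / P.c)).measurableSet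
  have hlt' : ∀ p ∈ P.A (t / P.c), P.g p - P.q * p.1 < 1 / P.c := fun p hp =>
    lt_of_le_of_lt (show _ ≤ t / P.c from hp) hlt
  have hset : (Sset (body F P) 0 (dir F P) t ∩ {r : E3 | IsRegularPt (body F P) r} : Set E3)
      =ᵐ[μH[2]] F.G P.g '' (P.A (t / P.c) ∩ P.D) := by
    rw [S_eq F P ht1]
    have hsub : F.G P.g '' (P.A (t / P.c) ∩ P.D) ⊆
        F.G P.g '' P.A (t / P.c) ∩ {r : E3 | IsRegularPt (body F P) r} := by
      rintro _ ⟨p, ⟨hp, hD⟩, rfl⟩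
      exact ⟨⟨p, hp, rfl⟩, regular F P hD (hlt' p hp)⟩
    symm
    refine (hsub.eventuallyLE).antisymm ?_
    rw [ae_le_set]
    refine measure_mono_null ?_ (G_null F P (t := t / P.c) (s := P.A (t / P.c) \ P.D) diff_subset (P.D_ae _))
    rintro r ⟨⟨⟨p, hp, rfl⟩, -⟩, h2⟩
    exact ⟨p, ⟨hp, fun hD => h2 ⟨p, ⟨hp, hD⟩, rfl⟩⟩, rfl⟩
  have hm : MeasurableSet (P.A (t / P.c) ∩ P.D) := hAm.inter P.D_meas
  have hrestr : (volume.restrict (P.A (t / P.c) ∩ P.D) : Measure R2) = volume.restrict (P.A (t / P.c)) := by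
    apply Measure.restrict_congr_set
    refine (inter_subset_left.eventuallyLE).antisymm ?_
    rw [ae_le_set, diff_self_inter]
    exact P.D_ae _
  rw [Measure.restrict_congr_set hset]
  have hcongr : normalMap (body F P) =ᵐ[μH[2].restrict (F.G P.g '' (P.A (t / P.c) ∩ P.D))]
      (fun p => Nv F (fderiv ℝ P.g p)) ∘ F.π := by
    rw [Filter.EventuallyEq, ae_restrict_iff' (F.G_meas P.g_cont hm)]
    refine Filter.Eventually.of_forall ?_
    rintro _ ⟨p, ⟨hp, hD⟩, rfl⟩
    rw [normalMap_eq F P hD (hlt' p hp), Function.comp, F.π_G]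
  rw [Measure.map_congr hcongr, ← Measure.map_map (measurable_Nf F P) F.π_cont.measurable,
    F.area_map P.g_cont hm (fun p hp => hp.2), hrestr]

/-- The integrand. -/
def Φ (f : BoundedContinuousFunction E3 ℝ) (l : R2 →L[ℝ] ℝ) : ℝ := (F.J l).toReal * f (Nv F l)

lemma Φ_cont (f : BoundedContinuousFunction E3 ℝ) : Continuous (Φ F f) := by
  unfold Φ
  refine Continuous.mul ?_ (f.continuous.comp (Nv_cont F))
  rw [continuous_iff_continuousAt]
  intro l
  exact (ENNReal.tendsto_toReal (F.J_lt_top l).ne).comp (F.J_cont.tendsto l)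

lemma nu_integral (f : BoundedContinuousFunction E3 ℝ) {t : ℝ} (ht1 : t < 1) :
    ∫ x, f x ∂(nuT (body F P) 0 (dir F P) t) =
      ((F.J (slopeB P)).toReal * (volume (P.A (t / P.c))).toReal)⁻¹ *
        ∫ p in P.A (t / P.c), Φ F f (fderiv ℝ P.g p) := by
  rw [nuT, nu_map F P ht1, B_meas F P ht1, integral_smul_measure,
    integral_map (measurable_Nf F P).aemeasurable f.continuous.aestronglyMeasurable,
    integral_withDensity_eq_integral_toReal_smul (measurable_Jf F P)
      (Filter.Eventually.of_forall fun p => F.J_lt_top _), ENNReal.toReal_inv, ENNReal.toReal_mul]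
  rfl

lemma scale {s : ℝ} (hs : s ≠ 0) (t : ℝ) (ht : 0 < t) (h : (R2 →L[ℝ] ℝ) → ℝ) :
    (volume (P.A (s ^ 2 * t))).toReal⁻¹ * ∫ p in P.A (s ^ 2 * t), h (fderiv ℝ P.g p) =
    (volume (P.A t)).toReal⁻¹ * ∫ p in P.A t, h ((fderiv ℝ P.g p).comp (Par.Rs s)) := by
  obtain ⟨κ, hκ, hmap⟩ : ∃ κ : ℝ, 0 < κ ∧
      Measure.map (Par.S s hs) (volume : Measure R2) = ENNReal.ofReal κ • volume := by
    have hdet : LinearMap.det ((Par.S s hs : R2 →L[ℝ] R2) : R2 →ₗ[ℝ] R2) ≠ 0 :=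
      (Par.S s hs).toLinearEquiv.isUnit_det'.ne_zero
    refine ⟨_, ?_, Measure.map_linearMap_addHaar_eq_smul_addHaar volume hdet⟩
    positivity
  have hemb : MeasurableEmbedding (Par.S s hs) := (Par.S s hs).toHomeomorph.measurableEmbedding
  have h1 : κ * ∫ p in P.A (s ^ 2 * t), h (fderiv ℝ P.g p) =
      ∫ p in P.A t, h ((fderiv ℝ P.g p).comp (Par.Rs s)) := by
    have := hemb.setIntegral_map (μ := volume) (fun p => h (fderiv ℝ P.g p)) (P.A (s ^ 2 * t))
    rw [hmap, P.A_S, Measure.restrict_smul, integral_smul_measure, ENNReal.toReal_ofReal hκ.le,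
      smul_eq_mul] at this
    rw [this]
    simp only [P.fderiv_S]
  have h2 : κ * (volume (P.A (s ^ 2 * t))).toReal = (volume (P.A t)).toReal := by
    have := hemb.map_apply volume (P.A (s ^ 2 * t))
    rw [hmap, P.A_S, Measure.smul_apply, smul_eq_mul] at this
    rw [← this, ENNReal.toReal_mul, ENNReal.toReal_ofReal hκ.le]
  rw [← h1, ← h2]
  field_simp

/-- The limit measure. -/
def nu0 : Measure E3 :=
  (F.J (slopeB P) * volume (P.A (1 / P.c)))⁻¹ •
    Measure.map (fun p => Nv F ((fderiv ℝ P.g p).comp (Par.Rs 0)))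
      ((volume.restrict (P.A (1 / P.c))).withDensity
        (fun p => F.J ((fderiv ℝ P.g p).comp (Par.Rs 0))))

lemma comp_cont (s : ℝ) : Continuous (fun l : R2 →L[ℝ] ℝ => l.comp (Par.Rs s)) := by fun_prop

lemma measurable_N0 : Measurable (fun p => Nv F ((fderiv ℝ P.g p).comp (Par.Rs 0))) :=
  ((Nv_cont F).comp (comp_cont 0)).measurable.comp (measurable_fderiv ℝ P.g)

lemma measurable_J0 : Measurable (fun p => F.J ((fderiv ℝ P.g p).comp (Par.Rs 0))) :=
  (F.J_cont.comp (comp_cont 0)).measurable.comp (measurable_fderiv ℝ P.g)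

lemma nu0_integral (f : BoundedContinuousFunction E3 ℝ) :
    ∫ x, f x ∂(nu0 F P) =
      ((F.J (slopeB P)).toReal * (volume (P.A (1 / P.c))).toReal)⁻¹ *
        ∫ p in P.A (1 / P.c), Φ F f ((fderiv ℝ P.g p).comp (Par.Rs 0)) := by
  rw [nu0, integral_smul_measure,
    integral_map (measurable_N0 F P).aemeasurable f.continuous.aestronglyMeasurable,
    integral_withDensity_eq_integral_toReal_smul (measurable_J0 F P)
      (Filter.Eventually.of_forall fun p => F.J_lt_top _), ENNReal.toReal_inv, ENNReal.toReal_mul]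
  rfl

lemma weak : WeaklyTendsto (nuT (body F P) 0 (dir F P)) (nu0 F P) := by
  intro f
  have hc := P.hc
  rw [nu0_integral]
  have hev : (fun t => ∫ x, f x ∂(nuT (body F P) 0 (dir F P) t)) =ᶠ[𝓝[>] (0 : ℝ)]
      fun t => ((F.J (slopeB P)).toReal * (volume (P.A (1 / P.c))).toReal)⁻¹ *
        ∫ p in P.A (1 / P.c), Φ F f ((fderiv ℝ P.g p).comp (Par.Rs (√t))) := by
    filter_upwards [Ioo_mem_nhdsGT (zero_lt_one (α := ℝ))] with t ht
    rw [nu_integral F P f ht.2]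
    have hs : √t ≠ 0 := (Real.sqrt_pos.2 ht.1).ne'
    have := scale P hs (1 / P.c) (by positivity) (Φ F f)
    rw [Real.sq_sqrt ht.1.le, mul_one_div] at this
    rw [mul_inv, mul_inv, mul_assoc, mul_assoc, this]
  refine Tendsto.congr' hev.symm ?_
  refine Tendsto.const_mul _ ?_
  obtain ⟨K, hK⟩ := P.fderiv_bound (1 / P.c)
  have hcomp : IsCompact ((fun z : ℝ × (R2 →L[ℝ] ℝ) => z.2.comp (Par.Rs z.1)) ''
      (Icc 0 1 ×ˢ Metric.closedBall 0 K)) := by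
    refine (isCompact_Icc.prod (isCompact_closedBall _ _)).image ?_
    have := Par.Rs_cont
    fun_prop
  obtain ⟨M, hM⟩ := hcomp.exists_bound_of_continuousOn (Φ_cont F f).continuousOn
  have hAm := (P.A_closed (1 / P.c)).measurableSet
  apply tendsto_integral_filter_of_dominated_convergence (fun _ => M)
  · refine Filter.Eventually.of_forall fun t => ?_
    exact (((Φ_cont F f).comp (comp_cont _)).measurable.comp
      (measurable_fderiv ℝ P.g)).aestronglyMeasurable
  · filter_upwards [Ioo_mem_nhdsGT (zero_lt_one (α := ℝ))] with t ht
    rw [ae_restrict_iff' hAm]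
    refine Filter.Eventually.of_forall fun p hp => ?_
    apply hM
    refine ⟨(√t, fderiv ℝ P.g p), ⟨⟨Real.sqrt_nonneg _, ?_⟩, ?_⟩, rfl⟩
    · exact Real.sqrt_le_one.2 ht.2.le
    · rw [mem_closedBall_zero_iff]; exact hK p hp
  · exact integrableOn_const (P.A_vol_lt _).ne
  · refine Filter.Eventually.of_forall fun p => ?_
    have h1 : Continuous (fun t : ℝ => Φ F f ((fderiv ℝ P.g p).comp (Par.Rs (√t)))) := by
      refine (Φ_cont F f).comp ?_
      have := Par.Rs_cont.comp Real.continuous_sqrt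
      exact (ContinuousLinearMap.compL ℝ R2 R2 ℝ (fderiv ℝ P.g p)).continuous.comp this
    have := h1.tendsto 0
    rw [Real.sqrt_zero] at this
    exact this.mono_left nhdsWithin_le_nhds

end

section
variable (F : Fr) (P : Par)

/-- The limiting normals. -/
def nT (T : ℝ) : E3 := ‖F.pt T 0 (-1)‖⁻¹ • F.pt T 0 (-1)

lemma nT_cont : Continuous (nT F) := by
  unfold nT
  have h : Continuous (fun T : ℝ => F.pt T 0 (-1)) :=
    F.pt_cont.comp (by fun_prop : Continuous (fun T : ℝ => (T, (0:ℝ), (-1:ℝ))))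
  exact (h.norm.inv₀ (fun T => (Nv_pos F T 0).ne')).smul h

lemma Nv_eq {p : R2} (hp : p ∈ P.D) {T : ℝ} (hT : T ∈ P.Ks) (h : P.g p = P.φ T p) :
    Nv F ((fderiv ℝ P.g p).comp (Par.Rs 0)) = nT F T := by
  rw [P.fderiv_eq hp hT h]
  have h1 : ((P.dφ T p).comp (Par.Rs 0)) (1, 0) = T := by
    rw [ContinuousLinearMap.comp_apply, Par.Rs_apply, P.dφ_apply]; simp
  have h2 : ((P.dφ T p).comp (Par.Rs 0)) (0, 1) = 0 := by
    rw [ContinuousLinearMap.comp_apply, Par.Rs_apply, P.dφ_apply]; simp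
  rw [Nv, h1, h2, nT]

lemma nu0_apply {U : Set E3} (hU : IsOpen U) :
    nu0 F P U = (F.J (slopeB P) * volume (P.A (1/P.c)))⁻¹ *
      ∫⁻ p in (fun p => Nv F ((fderiv ℝ P.g p).comp (Par.Rs 0))) ⁻¹' U,
        F.J ((fderiv ℝ P.g p).comp (Par.Rs 0)) ∂(volume.restrict (P.A (1/P.c))) := by
  rw [nu0, Measure.smul_apply, Measure.map_apply (measurable_N0 F P) hU.measurableSet,
    withDensity_apply _ (measurable_N0 F P hU.measurableSet), smul_eq_mul]

lemma supp_sub : msupport (nu0 F P) ⊆ nT F '' P.Ks := by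
  intro x hx
  by_contra hxn
  have hcl : IsClosed (nT F '' P.Ks) := (P.comp.image (nT_cont F)).isClosed
  have h := hx _ hcl.isOpen_compl hxn
  rw [nu0_apply F P hcl.isOpen_compl] at h
  apply h.ne'
  have h0 : volume.restrict (P.A (1/P.c))
      ((fun p => Nv F ((fderiv ℝ P.g p).comp (Par.Rs 0))) ⁻¹' (nT F '' P.Ks)ᶜ) = 0 := by
    rw [Measure.restrict_apply (measurable_N0 F P hcl.isOpen_compl.measurableSet)]
    refine measure_mono_null ?_ (P.D_ae (1/P.c))
    rintro p ⟨hp, hA⟩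
    refine ⟨hA, fun hD => hp ?_⟩
    obtain ⟨T, hT, hg⟩ := P.exists_active p
    exact ⟨T, hT, (Nv_eq F P hD hT hg).symm⟩
  rw [setLIntegral_measure_zero _ _ h0, mul_zero]

lemma sqrt_strict {T T0 : ℝ} (h : T ≠ T0) : 1 + T * T0 < √(1 + T ^ 2) * √(1 + T0 ^ 2) := by
  rw [← Real.sqrt_mul (by positivity)]
  apply Real.lt_sqrt_of_sq_lt
  have : 0 < (T - T0) ^ 2 := by have := sub_ne_zero.2 h; positivity
  nlinarith

lemma φ_strict {T T0 z : ℝ} (hz : 0 < z) (h : T ≠ T0) :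
    P.φ T (z ^ 2 * (T0 / √(1 + T0 ^ 2)), z) < P.φ T0 (z ^ 2 * (T0 / √(1 + T0 ^ 2)), z) := by
  simp only [Par.φ, Par.w]
  have h1 := sqrt_strict h
  have hs : 0 < √(1 + T0 ^ 2) := by positivity
  have h2 : √(1 + T0 ^ 2) ^ 2 = 1 + T0 ^ 2 := Real.sq_sqrt (by positivity)
  set s := √(1 + T0 ^ 2)
  set r := √(1 + T ^ 2)
  have h3 : T0 / s * T - r < T0 / s * T0 - s := by
    have e1 : T0 / s * T - r = (T0 * T - r * s) / s := by field_simp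
    have e2 : T0 / s * T0 - s = (T0 * T0 - s ^ 2) / s := by field_simp
    rw [e1, e2]
    apply div_lt_div_of_pos_right _ hs
    nlinarith
  have hz2 : 0 < z ^ 2 := by positivity
  nlinarith

lemma sub_supp : nT F '' P.Ks ⊆ msupport (nu0 F P) := by
  rintro _ ⟨T0, hT0, rfl⟩ U hU hx
  have hV : IsOpen (nT F ⁻¹' U) := hU.preimage (nT_cont F)
  have hKV : IsCompact (P.Ks \ nT F ⁻¹' U) := P.comp.diff hV
  have hzz : ∃ z : ℝ, 0 < z ∧ P.g (z ^ 2 * (T0 / √(1 + T0 ^ 2)), z)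
      - P.q * (z ^ 2 * (T0 / √(1 + T0 ^ 2))) < 1 / P.c := by
    have hc : Continuous (fun z : ℝ => P.g (z ^ 2 * (T0 / √(1 + T0 ^ 2)), z)
      - P.q * (z ^ 2 * (T0 / √(1 + T0 ^ 2)))) := by
      have h := P.g_cont.comp (by fun_prop : Continuous (fun z : ℝ => ((z ^ 2 * (T0 / √(1 + T0 ^ 2)), z) : R2)))
      exact h.sub (by fun_prop)
    have h0 := hc.tendsto 0
    have e0 : P.g ((0:ℝ) ^ 2 * (T0 / √(1 + T0 ^ 2)), 0) = 0 := by
      have : ((0:ℝ) ^ 2 * (T0 / √(1 + T0 ^ 2)), (0:ℝ)) = (0 : R2) := by ext <;> simp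
      rw [this, P.g_zero]
    simp only [e0] at h0
    have h1 := h0.eventually (gt_mem_nhds (show (0 - P.q * ((0:ℝ) ^ 2 * (T0 / √(1 + T0 ^ 2)))) < 1 / P.c by
      simpa using P.hc))
    have h2 : ∀ᶠ z in 𝓝[>] (0:ℝ), 0 < z := self_mem_nhdsWithin
    obtain ⟨z, h3, h4⟩ := (h2.and (h1.filter_mono nhdsWithin_le_nhds)).exists
    exact ⟨z, h3, h4⟩
  obtain ⟨z, hz, hgz⟩ := hzz
  set p0 : R2 := (z ^ 2 * (T0 / √(1 + T0 ^ 2)), z) with hp0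
  have hev1 : ∀ᶠ p in 𝓝 p0, ∀ T ∈ P.Ks \ nT F ⁻¹' U, P.φ T p < P.φ T0 p := by
    apply hKV.eventually_forall_of_forall_eventually
    intro T hT
    have hne : T ≠ T0 := by rintro rfl; exact hT.2 hx
    have hc1 : Continuous (fun x : R2 × ℝ => P.φ x.2 x.1) := by unfold Par.φ Par.w; fun_prop
    have hc2 : Continuous (fun x : R2 × ℝ => P.φ T0 x.1) := by unfold Par.φ Par.w; fun_prop
    exact (isOpen_lt hc1 hc2).mem_nhds (φ_strict P hz hne)
  have hev2 : ∀ᶠ p in 𝓝 p0, P.g p - P.q * p.1 < 1 / P.c :=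
    (isOpen_lt (by have := P.g_cont; fun_prop) continuous_const).mem_nhds hgz
  obtain ⟨W, hW, hWo, hpW⟩ := eventually_nhds_iff.1 (hev1.and hev2)
  have hWA : W ⊆ P.A (1 / P.c) := fun p hp => (hW p hp).2.le
  have hvol : 0 < volume (W ∩ P.D) := by
    have h1 : 0 < volume W := hWo.measure_pos volume ⟨p0, hpW⟩
    have h2 : volume (W \ P.D) = 0 :=
      measure_mono_null (sdiff_subset_sdiff_left hWA) (P.D_ae _)
    rw [← measure_inter_add_sdiff W P.D_meas, h2, add_zero] at h1
    exact h1
  have hsub : W ∩ P.D ⊆ (fun p => Nv F ((fderiv ℝ P.g p).comp (Par.Rs 0))) ⁻¹' U := by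
    rintro p ⟨hpW, hpD⟩
    obtain ⟨T, hT, hg⟩ := P.exists_active p
    show Nv F ((fderiv ℝ P.g p).comp (Par.Rs 0)) ∈ U
    rw [Nv_eq F P hpD hT hg]
    by_contra hn
    have h1 := (hW p hpW).1 T ⟨hT, hn⟩
    have h2 := P.φ_le hT0 p
    linarith
  rw [nu0_apply F P hU]
  have hfin : F.J (slopeB P) * volume (P.A (1/P.c)) < ⊤ :=
    ENNReal.mul_lt_top (F.J_lt_top _) (P.A_vol_lt _)
  apply ENNReal.mul_pos (ENNReal.inv_ne_zero.2 hfin.ne)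
  apply ne_of_gt
  refine hvol.trans_le ?_
  have hm := measurable_N0 F P hU.measurableSet
  calc volume (W ∩ P.D) ≤ volume.restrict (P.A (1/P.c))
        ((fun p => Nv F ((fderiv ℝ P.g p).comp (Par.Rs 0))) ⁻¹' U) := by
        rw [Measure.restrict_apply hm]
        exact measure_mono fun p hp => ⟨hsub hp, hWA hp.1⟩
    _ = ∫⁻ p in (fun p => Nv F ((fderiv ℝ P.g p).comp (Par.Rs 0))) ⁻¹' U,
        1 ∂(volume.restrict (P.A (1/P.c))) := by rw [setLIntegral_one]
    _ ≤ _ := lintegral_mono fun p => F.one_le_J _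

lemma supp_eq : msupport (nu0 F P) = nT F '' P.Ks :=
  Subset.antisymm (supp_sub F P) (sub_supp F P)

lemma nT_eq {T a : ℝ} {x : E3} (ha : 0 ≤ a) (h : x = a • F.pt T 0 (-1)) (hx : ‖x‖ = 1) : nT F T = x := by
  have h1 : a * ‖F.pt T 0 (-1)‖ = 1 := by
    have h0 := hx
    rwa [h, norm_smul, Real.norm_eq_abs, abs_of_nonneg ha] at h0
  have h2 := Nv_pos F T 0
  have h3 : ‖F.pt T 0 (-1)‖⁻¹ = a := by
    rw [inv_eq_one_div, eq_comm, eq_div_iff h2.ne']; exact h1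
  rw [nT, h3, h]

end

/-- Existence of the frame. -/
lemma exists_frame (b τ : E3) (hb : ⟪b, b⟫ = 1) (ht : ⟪τ, τ⟫ = 1) (hbt : ⟪b, τ⟫ = 0) :
    ∃ F : Fr, F.b = b ∧ F.τ = τ := by
  have hbn : ‖b‖ = 1 := by
    have := real_inner_self_eq_norm_sq b; rw [hb] at this; nlinarith [norm_nonneg b]
  have htn : ‖τ‖ = 1 := by
    have := real_inner_self_eq_norm_sq τ; rw [ht] at this; nlinarith [norm_nonneg τ]
  have htb : ⟪τ, b⟫ = 0 := by rw [real_inner_comm]; exact hbt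
  let v : Fin 3 → E3 := ![b, τ, 0]
  let s : Set (Fin 3) := {0, 1}
  have hv : Orthonormal ℝ (s.domRestrict v) := by
    constructor
    · rintro ⟨i, hi⟩
      rcases hi with rfl | hi
      · exact hbn
      · rw [mem_singleton_iff] at hi; subst hi; exact htn
    · rintro ⟨i, hi⟩ ⟨j, hj⟩ hij
      rcases hi with rfl | hi <;> rcases hj with rfl | hj
      · exact absurd rfl hij
      · rw [mem_singleton_iff] at hj; subst hj; exact hbt
      · rw [mem_singleton_iff] at hi; subst hi; exact htb
      · rw [mem_singleton_iff] at hi hj; subst hi; subst hj; exact absurd rfl hij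
  obtain ⟨B, hB⟩ := hv.exists_orthonormalBasis_extension_of_card_eq (by simp)
  have h0 : B 0 = b := hB 0 (by simp [s])
  have h1 : B 1 = τ := hB 1 (by simp [s])
  have hin : ∀ i j, i ≠ j → ⟪B i, B j⟫ = 0 := fun i j h => B.orthonormal.2 h
  refine ⟨⟨b, τ, B 2, hb, ht, ?_, hbt, ?_, ?_, ?_⟩, rfl, rfl⟩
  · rw [real_inner_self_eq_norm_sq, B.orthonormal.1 2]; norm_num
  · rw [← h0]; exact hin _ _ (by decide)
  · rw [← h1]; exact hin _ _ (by decide)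
  · intro r
    have := B.sum_repr' r
    rw [Fin.sum_univ_three, h0, h1, real_inner_comm, real_inner_comm r τ,
      real_inner_comm r (B 2)] at this
    conv_lhs => rw [← this]
    module

/-- **Theorem 3 (paper Thm 1.3).** Every closed subset `K` of the arc `Γ` containing its
endpoints `e₁` and `e₂` is realized as the support of the weak limit of the measures
`ν_t` for some convex body `C` and ridge point `r₀ ∈ ∂C`. -/
theorem exists_body_with_limit_support_eq
    (e₁ e₂ e : E3) (lam₁ lam₂ : ℝ)
    (he₁ : ‖e₁‖ = 1) (he₂ : ‖e₂‖ = 1) (hne : e₁ ≠ e₂) (hne' : e₁ ≠ -e₂)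
    (hl₁ : 0 < lam₁) (hl₂ : 0 < lam₂) (he : e = lam₁ • e₁ + lam₂ • e₂) (hnorm : ‖e‖ = 1)
    (K : Set E3) (hK : IsClosed K) (hKΓ : K ⊆ arcGamma e₁ e₂) (hKe₁ : e₁ ∈ K) (hKe₂ : e₂ ∈ K) :
    ∃ (C : Set E3) (r₀ : E3) (ν₀ : Measure E3),
      IsConvexBody C ∧ r₀ ∈ frontier C ∧
      tanCone C r₀ = dihedral e₁ e₂ ∧
      WeaklyTendsto (nuT C r₀ e) ν₀ ∧
      msupport ν₀ = K := by
  have h11 : ⟪e₁, e₁⟫ = 1 := by rw [real_inner_self_eq_norm_sq, he₁]; norm_num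
  have h22 : ⟪e₂, e₂⟫ = 1 := by rw [real_inner_self_eq_norm_sq, he₂]; norm_num
  have h21 : ⟪e₂, e₁⟫ = ⟪e₁, e₂⟫ := real_inner_comm _ _
  have hp : 0 < ‖e₁ + e₂‖ := norm_pos_iff.2 fun h => hne' (eq_neg_of_add_eq_zero_left h)
  have hm : 0 < ‖e₁ - e₂‖ := norm_pos_iff.2 (sub_ne_zero.2 hne)
  have hp2 : ⟪e₁ + e₂, e₁ + e₂⟫ = ‖e₁ + e₂‖ ^ 2 := real_inner_self_eq_norm_sq _
  have hm2 : ⟪e₁ - e₂, e₁ - e₂⟫ = ‖e₁ - e₂‖ ^ 2 := real_inner_self_eq_norm_sq _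
  have hpm : ⟪e₁ + e₂, e₁ - e₂⟫ = 0 := by
    rw [inner_add_left, inner_sub_right, inner_sub_right, h11, h22, h21]; ring
  obtain ⟨F, hFb, hFt⟩ := exists_frame (‖e₁ + e₂‖⁻¹ • (e₁ + e₂)) (‖e₁ - e₂‖⁻¹ • (e₁ - e₂))
    (by rw [real_inner_smul_left, real_inner_smul_right, hp2]; field_simp)
    (by rw [real_inner_smul_left, real_inner_smul_right, hm2]; field_simp)
    (by rw [real_inner_smul_left, real_inner_smul_right, hpm]; ring)
  obtain ⟨κ, hκ⟩ : ∃ κ, κ = ‖e₁ + e₂‖ / 2 := ⟨_, rfl⟩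
  obtain ⟨k, hkk⟩ : ∃ k, k = ‖e₁ - e₂‖ / ‖e₁ + e₂‖ := ⟨_, rfl⟩
  have hκ0 : 0 < κ := by rw [hκ]; positivity
  have hk0 : 0 < k := by rw [hkk]; positivity
  have hpb : (2 * κ) • F.b = e₁ + e₂ := by
    rw [hFb, smul_smul, hκ, mul_div_cancel₀ _ (two_ne_zero), mul_inv_cancel₀ hp.ne', one_smul]
  have hmt : (2 * κ * k) • F.τ = e₁ - e₂ := by
    have : 2 * κ * k = ‖e₁ - e₂‖ := by rw [hκ, hkk]; field_simp
    rw [hFt, smul_smul, this, mul_inv_cancel₀ hm.ne', one_smul]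
  have hE1 : e₁ = κ • F.pt k 0 (-1) := by
    have h1 : e₁ = (1/2 : ℝ) • ((e₁ + e₂) + (e₁ - e₂)) := by module
    rw [h1, ← hpb, ← hmt, Fr.pt]; module
  have hE2 : e₂ = κ • F.pt (-k) 0 (-1) := by
    have h1 : e₂ = (1/2 : ℝ) • ((e₁ + e₂) - (e₁ - e₂)) := by module
    rw [h1, ← hpb, ← hmt, Fr.pt]; module
  have hn1 : nT F k = e₁ := nT_eq F hκ0.le hE1 he₁
  have hn2 : nT F (-k) = e₂ := nT_eq F hκ0.le hE2 he₂
  have hcomb : ∀ m₁ m₂ : ℝ, 0 < m₁ + m₂ → m₁ • e₁ + m₂ • e₂ =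
      ((m₁ + m₂) * κ) • F.pt ((m₁ - m₂) / (m₁ + m₂) * k) 0 (-1) := by
    intro m₁ m₂ h
    have h1 : m₁ • e₁ + m₂ • e₂ =
        ((m₁ + m₂) * κ) • F.b + ((m₁ - m₂) * κ * k) • F.τ := by
      rw [hE1, hE2]; simp only [Fr.pt]; module
    have h2 : (m₁ - m₂) * κ * k = ((m₁ + m₂) * κ) * ((m₁ - m₂) / (m₁ + m₂) * k) := by
      field_simp
    rw [h1, h2, Fr.pt]; module
  have hls : 0 < lam₁ + lam₂ := by linarith
  let P : Par :=
    { k := k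
      hk := hk0
      Ks := Icc (-k) k ∩ nT F ⁻¹' K
      comp := isCompact_Icc.inter_right (hK.preimage (nT_cont F))
      sub := inter_subset_left
      mem := ⟨⟨by linarith, le_rfl⟩, by rw [mem_preimage, hn1]; exact hKe₁⟩
      mem' := ⟨⟨le_rfl, by linarith⟩, by rw [mem_preimage, hn2]; exact hKe₂⟩
      q := (lam₁ - lam₂) / (lam₁ + lam₂) * k
      hq := by
        have : |(lam₁ - lam₂) / (lam₁ + lam₂)| < 1 := by
          rw [abs_div, abs_of_pos hls, div_lt_one hls, abs_lt]
          constructor <;> linarith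
        rw [abs_mul, abs_of_pos hk0]
        nlinarith
      c := (lam₁ + lam₂) * κ
      hc := by positivity }
  have hdir : e = dir F P := by
    rw [he, hcomb _ _ hls, F.smul_pt]
    show _ = F.pt (P.c * P.q) 0 (-P.c)
    rw [mul_zero, mul_neg, mul_one]
  refine ⟨body F P, 0, nu0 F P, body_convexBody F P, zero_frontier F P, ?_, ?_, ?_⟩
  · rw [tanCone_body F P hκ0, hE1, hE2]
  · rw [hdir]; exact weak F P
  · rw [supp_eq]
    apply Subset.antisymm
    · rintro _ ⟨T, hT, rfl⟩
      exact hT.2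
    · intro x hx
      obtain ⟨m₁, m₂, h1, h2, hxe, hxn⟩ := hKΓ hx
      have hs : 0 < m₁ + m₂ := by
        rcases (add_nonneg h1 h2).lt_or_eq with h | h
        · exact h
        · exfalso
          have a1 : m₁ = 0 := by linarith
          have a2 : m₂ = 0 := by linarith
          rw [hxe, a1, a2, zero_smul, zero_smul, add_zero, norm_zero] at hxn
          exact zero_ne_one hxn
      have hx2 := nT_eq F (by positivity) (hxe.trans (hcomb _ _ hs)) hxn
      refine ⟨(m₁ - m₂) / (m₁ + m₂) * k, ⟨?_, ?_⟩, hx2⟩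
      · have a1 : (m₁ - m₂) / (m₁ + m₂) ≤ 1 := by rw [div_le_one hs]; linarith
        have a2 : -1 ≤ (m₁ - m₂) / (m₁ + m₂) := by rw [le_div_iff₀ hs]; linarith
        constructor <;> nlinarith
      · rw [mem_preimage, hx2]; exact hx
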